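/- Let λ ∈ (−π/2, π/2), f ∈ F_λ, and β_λ(t, f) = lim_{r→1−} u_f(r e^{it}) + t. Let t₀ ∈ ℝ and θ ∈ (0, 2π]. If β_λ(t₀+, f) − β_λ(t₀−, f) = θ, then the λ-spiral sector S_λ(β_λ(t₀, f), θ) = { exp(iψ + s·e^{iλ}) : s ∈ ℝ, |ψ − β_λ(t₀, f)| < θ/2 } is contained in the image f(𝔻), and it is maximal: there are no θ' > θ and θ₀' ∈ ℝ with S_λ(β_λ(t₀, f), θ) ⊂ S_λ(θ₀', θ') ⊂ f(𝔻). Conversely, if f(𝔻) contains a maximal λ-spiral sector S_λ(β_λ(t₀, f), θ), then β_λ(t₀+, f) − β_λ(t₀−, f) = θ. -/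

import Mathlib

open Set Metric Filter Topology Function

/-- The class `F_λ` of (normalized) `λ`-spirallike functions on the unit disk. -/
def SpiralClass (lam : ℝ) : Set (ℂ → ℂ) :=
  {f | DifferentiableOn ℂ f (ball (0 : ℂ) 1) ∧ f 0 = 0 ∧ deriv f 0 = 1 ∧
    (∀ z ∈ ball (0 : ℂ) 1, z ≠ 0 → f z ≠ 0) ∧
    ∀ z ∈ ball (0 : ℂ) 1, z ≠ 0 →
      0 < (Complex.exp (-(lam : ℂ) * Complex.I) * z * deriv f z / f z).re}

/-- `L` is the (unique) analytic branch of `log (f z / z)` on the disk vanishing at `0`. -/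
def IsLogBranch (f L : ℂ → ℂ) : Prop :=
  DifferentiableOn ℂ L (ball (0 : ℂ) 1) ∧ L 0 = 0 ∧
    ∀ z ∈ ball (0 : ℂ) 1, z ≠ 0 → Complex.exp (L z) = f z / z

/-- The canonical harmonic branch `u_f = Im L_f − (tan λ)·Re L_f` of the
`λ`-argument of `f(z)/z`. -/
noncomputable def lambdaArgBranch (lam : ℝ) (L : ℂ → ℂ) (z : ℂ) : ℝ :=
  (L z).im - Real.tan lam * (L z).re

/-- The `λ`-spiral sector `S_λ(θ₀, a) = {exp(iψ + s e^{iλ}) : s ∈ ℝ, |ψ − θ₀| < a/2}`. -/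
def spiralSector (lam θ₀ a : ℝ) : Set ℂ :=
  {w | ∃ s ψ : ℝ, |ψ - θ₀| < a / 2 ∧
    w = Complex.exp ((ψ : ℂ) * Complex.I + (s : ℂ) * Complex.exp ((lam : ℂ) * Complex.I))}

/-- `S_λ(θ₀, a)` is a maximal `λ`-spiral sector in `Ω`: it is contained in `Ω` and it is
contained in no strictly larger `λ`-spiral sector contained in `Ω`. -/
def IsMaximalSpiralSector (lam θ₀ a : ℝ) (Ω : Set ℂ) : Prop :=
  spiralSector lam θ₀ a ⊆ Ω ∧
    ¬∃ a' θ₀' : ℝ, a < a' ∧ spiralSector lam θ₀ a ⊆ spiralSector lam θ₀' a' ∧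
      spiralSector lam θ₀' a' ⊆ Ω



/-- Normalised Poisson kernel of the unit disk. -/
noncomputable def pK (z : ℂ) (t : ℝ) : ℝ :=
  (2 * Real.pi)⁻¹ * ((1 - ‖z‖ ^ 2) / ‖Complex.exp (t * Complex.I) - z‖ ^ 2)

lemma pK_nonneg {z : ℂ} (hz : z ∈ ball (0 : ℂ) 1) (t : ℝ) : 0 ≤ pK z t := by
  have : ‖z‖ < 1 := by simpa using hz
  have h2 : 0 ≤ 1 - ‖z‖ ^ 2 := by nlinarith [norm_nonneg z]
  unfold pK
  positivity

lemma exp_sub_ne {z : ℂ} (hz : z ∈ ball (0 : ℂ) 1) (t : ℝ) :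
    Complex.exp (t * Complex.I) - z ≠ 0 := by
  intro h
  have : ‖z‖ < 1 := by simpa using hz
  rw [← sub_eq_zero.1 h, Complex.norm_exp_ofReal_mul_I] at this
  exact lt_irrefl _ this

lemma pK_continuous {z : ℂ} (hz : z ∈ ball (0 : ℂ) 1) : Continuous (pK z) := by
  unfold pK
  refine continuous_const.mul (continuous_const.div (by fun_prop) ?_)
  intro t
  have := exp_sub_ne hz t
  positivity

lemma mul_mem_unit {ρ : ℝ} (h0 : 0 ≤ ρ) (h1 : ρ < 1) {w : ℂ} (hw : ‖w‖ ≤ 1) :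
    (ρ : ℂ) * w ∈ ball (0 : ℂ) 1 := by
  simp only [mem_ball, dist_zero_right, norm_mul, Complex.norm_real, Real.norm_eq_abs,
    abs_of_nonneg h0]
  nlinarith [norm_nonneg w]

lemma poisson_re (N : ℂ → ℂ) (hN : DifferentiableOn ℂ N (ball (0 : ℂ) 1)) {ρ : ℝ}
    (h0 : 0 ≤ ρ) (h1 : ρ < 1) {z : ℂ} (hz : z ∈ ball (0 : ℂ) 1) :
    ∫ t in (-Real.pi)..Real.pi, pK z t * (N (ρ * Complex.exp (t * Complex.I))).re
      = (N (ρ * z)).re := by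
  have hd : DifferentiableOn ℂ (fun w => N (ρ * w)) (closedBall (0 : ℂ) 1) := by
    refine hN.comp (by fun_prop) ?_
    intro w hw
    exact mul_mem_unit h0 h1 (by simpa using hw)
  have hdc : DiffContOnCl ℂ (fun w => N (ρ * w)) (ball (0 : ℂ) 1) := by
    apply DifferentiableOn.diffContOnCl
    rwa [closure_ball _ one_ne_zero]
  have key := hdc.circleAverage_poissonKernel_smul hz
  have hcont : Continuous fun t : ℝ => N (ρ * Complex.exp (t * Complex.I)) := by
    have := hd.continuousOn.comp_continuous (f := fun t : ℝ => Complex.exp (t * Complex.I))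
      (by fun_prop) (fun t => by simp [Complex.norm_exp_ofReal_mul_I])
    simpa [Function.comp_def] using this
  have hkc := pK_continuous hz
  rw [Real.circleAverage_eq_integral_add (-Real.pi)] at key
  rw [intervalIntegral.integral_comp_add_right
    (fun θ => (poissonKernel 0 z • fun w => N (ρ * w)) (circleMap 0 1 θ))] at key
  have e1 : (0 : ℝ) + -Real.pi = -Real.pi := by ring
  have e2 : 2 * Real.pi + -Real.pi = Real.pi := by ring
  rw [e1, e2, ← intervalIntegral.integral_smul] at key
  have e3 : ∀ t : ℝ, (2 * Real.pi)⁻¹ • (poissonKernel 0 z • fun w => N (ρ * w)) (circleMap 0 1 t)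
      = (pK z t : ℂ) * N (ρ * Complex.exp (t * Complex.I)) := by
    intro t
    simp [pK, poissonKernel, circleMap]
    ring
  simp_rw [e3] at key
  rw [← key]
  have := Complex.reCLM.intervalIntegral_comp_comm (μ := MeasureTheory.volume)
    (a := -Real.pi) (b := Real.pi)
    (f := fun t : ℝ => (pK z t : ℂ) * N (ρ * Complex.exp (t * Complex.I)))
    (Continuous.intervalIntegrable ((Complex.continuous_ofReal.comp hkc).mul hcont) _ _)
  simpa using this

lemma pK_integral {z : ℂ} (hz : z ∈ ball (0 : ℂ) 1) :
    ∫ t in (-Real.pi)..Real.pi, pK z t = 1 := by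
  have := poisson_re (fun _ => 1) (by fun_prop) (le_refl 0) one_pos hz
  simpa using this

lemma pK_unif (u : Set ℝ) (hu : IsOpen u) (h0 : (0 : ℝ) ∈ u) :
    TendstoUniformlyOn pK 0 (𝓝[ball (0 : ℂ) 1] 1) (Ioo (-Real.pi) Real.pi \ u) := by
  obtain ⟨d, hd, hdt⟩ : ∃ d > 0, ∀ t ∈ Icc (-Real.pi) Real.pi \ u,
      d ≤ ‖Complex.exp (t * Complex.I) - 1‖ := by
    have hc : IsCompact (Icc (-Real.pi) Real.pi \ u) := isCompact_Icc.diff hu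
    rcases (Icc (-Real.pi) Real.pi \ u).eq_empty_or_nonempty with he | hne
    · exact ⟨1, one_pos, by simp [he]⟩
    · obtain ⟨x, hx, hmin⟩ := hc.exists_isMinOn hne
        (f := fun t : ℝ => ‖Complex.exp (t * Complex.I) - 1‖) (by fun_prop)
      refine ⟨_, ?_, fun t ht => hmin ht⟩
      rw [gt_iff_lt, norm_pos_iff, sub_ne_zero]
      intro h
      rw [Complex.exp_eq_one_iff] at h
      obtain ⟨n, hn⟩ := h
      have hn' : x = n * (2 * Real.pi) := by
        have := congrArg Complex.im hn
        simpa using this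
      have hpi := Real.pi_pos
      have hx1 := hx.1
      have : n = 0 := by
        have a1 : (n : ℝ) < 1 := by
          by_contra! h
          nlinarith [hx1.2]
        have a2 : (-1 : ℝ) < n := by
          by_contra! h
          nlinarith [hx1.1]
        norm_cast at a1 a2
        omega
      apply hx.2
      rw [hn', this]; simpa using h0
  rw [Metric.tendstoUniformlyOn_iff]
  intro ε hε
  have t1 : Tendsto (fun z : ℂ => (2 * Real.pi)⁻¹ * ((1 - ‖z‖ ^ 2) / (d / 2) ^ 2))
      (𝓝[ball (0 : ℂ) 1] 1) (𝓝 0) := by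
    have : Continuous fun z : ℂ => (2 * Real.pi)⁻¹ * ((1 - ‖z‖ ^ 2) / (d / 2) ^ 2) := by fun_prop
    have h := this.tendsto 1
    simp only [norm_one, one_pow, sub_self, zero_div, mul_zero] at h
    exact h.mono_left nhdsWithin_le_nhds
  have t2 : ∀ᶠ z in 𝓝[ball (0 : ℂ) 1] (1 : ℂ), z ∈ ball (1 : ℂ) (d / 2) :=
    nhdsWithin_le_nhds (ball_mem_nhds _ (by positivity))
  filter_upwards [t1.eventually (gt_mem_nhds hε), t2, self_mem_nhdsWithin] with z h1 h2 h3 t ht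
  have hz1 : ‖z‖ < 1 := by simpa using h3
  have hzz : 0 ≤ 1 - ‖z‖ ^ 2 := by nlinarith [norm_nonneg z]
  simp only [Pi.zero_apply, dist_zero_left, Real.norm_eq_abs, abs_of_nonneg (pK_nonneg h3 t)]
  refine lt_of_le_of_lt ?_ h1
  have hdist : d / 2 ≤ ‖Complex.exp (t * Complex.I) - z‖ := by
    have a := hdt t ⟨⟨ht.1.1.le, ht.1.2.le⟩, ht.2⟩
    have b : ‖z - 1‖ < d / 2 := by simpa [dist_eq_norm] using h2
    have c := norm_add_le (Complex.exp (t * Complex.I) - z) (z - 1)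
    rw [sub_add_sub_cancel] at c
    linarith
  unfold pK
  gcongr

lemma poisson_limit (N : ℂ → ℂ) (hN : DifferentiableOn ℂ N (ball (0 : ℂ) 1)) (C : ℝ)
    (hC : ∀ᶠ r : ℝ in 𝓝[<] (1 : ℝ), ∀ t : ℝ, |(N (r * Complex.exp (t * Complex.I))).re| ≤ C)
    (b : ℝ → ℝ)
    (hb : ∀ t ∈ Ioo (-Real.pi) Real.pi, t ≠ 0 →
      Tendsto (fun r : ℝ => (N (r * Complex.exp (t * Complex.I))).re) (𝓝[<] 1) (𝓝 (b t)))
    (l : ℝ) (hl : Tendsto b (𝓝[≠] 0) (𝓝 l)) :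
    Tendsto (fun z => (N z).re) (𝓝[ball (0 : ℂ) 1] 1) (𝓝 l) := by
  classical
  set g : ℝ → ℝ := Function.update b 0 l with hg
  set s := Ioo (-Real.pi) Real.pi with hs
  have hgl : Tendsto g (𝓝 0) (𝓝 l) := by
    have : ContinuousAt g 0 := continuousAt_update_same.2 hl
    have h := this.tendsto
    simpa [hg] using h
  have hae : ∀ᵐ t : ℝ ∂(MeasureTheory.volume.restrict s),
      Tendsto (fun r : ℝ => (N (r * Complex.exp (t * Complex.I))).re) (𝓝[<] 1) (𝓝 (g t)) := by
    have h0 : ∀ᵐ t : ℝ ∂(MeasureTheory.volume.restrict s), t ≠ (0 : ℝ) :=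
      MeasureTheory.ae_restrict_of_ae (MeasureTheory.Measure.ae_ne _ 0)
    filter_upwards [h0, MeasureTheory.ae_restrict_mem measurableSet_Ioo] with t ht1 ht2
    rw [hg, Function.update_of_ne ht1]
    exact hb t ht2 ht1
  have hr01 : ∀ᶠ r : ℝ in 𝓝[<] (1 : ℝ), 0 ≤ r ∧ r < 1 := by
    have : Ioo (0 : ℝ) 1 ∈ 𝓝[<] (1 : ℝ) := Ioo_mem_nhdsLT one_pos
    filter_upwards [this] with r hr using ⟨hr.1.le, hr.2⟩
  have hcont : ∀ᶠ r : ℝ in 𝓝[<] (1 : ℝ),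
      Continuous fun t : ℝ => (N (r * Complex.exp (t * Complex.I))).re := by
    filter_upwards [hr01] with r hr
    refine Complex.continuous_re.comp ?_
    refine hN.continuousOn.comp_continuous (by fun_prop) (fun t => ?_)
    exact mul_mem_unit hr.1 hr.2 (by simp [Complex.norm_exp_ofReal_mul_I])
  have hmeas : MeasureTheory.AEStronglyMeasurable g (MeasureTheory.volume.restrict s) := by
    obtain ⟨rs, hrs⟩ := exists_seq_tendsto (𝓝[<] (1 : ℝ))
    obtain ⟨n0, hn0⟩ := eventually_atTop.1 (hrs.eventually hcont)
    have hrs' : Tendsto (fun n => rs (n + n0)) atTop (𝓝[<] (1 : ℝ)) :=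
      hrs.comp (tendsto_add_atTop_nat n0)
    refine aestronglyMeasurable_of_tendsto_ae atTop
      (f := fun (n : ℕ) (t : ℝ) => (N (rs (n + n0) * Complex.exp (t * Complex.I))).re) ?_ ?_
    · intro n
      exact (hn0 _ (by omega)).aestronglyMeasurable
    · filter_upwards [hae] with t ht
      exact ht.comp hrs'
  have hgb : ∀ᵐ t : ℝ ∂(MeasureTheory.volume.restrict s), ‖g t‖ ≤ C := by
    filter_upwards [hae] with t ht
    refine le_of_tendsto ht.norm ?_
    filter_upwards [hC] with r hr using hr t
  have hgi : MeasureTheory.IntegrableOn g s := by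
    refine ⟨hmeas, MeasureTheory.HasFiniteIntegral.of_bounded hgb⟩
  have hpi := Real.pi_pos
  have hrep : ∀ z ∈ ball (0 : ℂ) 1, (N z).re = ∫ t in s, pK z t • g t := by
    intro z hz
    have l1 : Tendsto (fun r : ℝ => (N (r * z)).re) (𝓝[<] 1) (𝓝 (N z).re) := by
      have hc : ContinuousAt (fun r : ℝ => (N (r * z)).re) 1 := by
        have hN' : ContinuousAt N ((1 : ℝ) * z) := by
          simpa using (hN.differentiableAt (isOpen_ball.mem_nhds hz)).continuousAt
        have h2 : ContinuousAt (fun r : ℝ => (r : ℂ) * z) 1 := by fun_prop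
        exact Complex.continuous_re.continuousAt.comp (ContinuousAt.comp (f := fun r : ℝ => (r : ℂ) * z) hN' h2)
      have := hc.tendsto
      simp only [Complex.ofReal_one, one_mul] at this
      exact this.mono_left nhdsWithin_le_nhds
    have l2 : Tendsto (fun r : ℝ => ∫ t in s, pK z t * (N (r * Complex.exp (t * Complex.I))).re)
        (𝓝[<] 1) (𝓝 (∫ t in s, pK z t • g t)) := by
      refine MeasureTheory.tendsto_integral_filter_of_dominated_convergence
        (fun t => pK z t * C) ?_ ?_ ?_ ?_
      · filter_upwards [hcont] with r hr
        exact ((pK_continuous hz).mul hr).aestronglyMeasurable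
      · filter_upwards [hC] with r hr
        refine Eventually.of_forall fun t => ?_
        rw [norm_mul, Real.norm_eq_abs, Real.norm_eq_abs, abs_of_nonneg (pK_nonneg hz t)]
        exact mul_le_mul_of_nonneg_left (hr t) (pK_nonneg hz t)
      · have : Continuous fun t => pK z t * C := (pK_continuous hz).mul continuous_const
        exact (this.integrableOn_Icc (a := -Real.pi) (b := Real.pi)).mono_set Ioo_subset_Icc_self
      · filter_upwards [hae] with t ht
        exact ht.const_mul _
    refine tendsto_nhds_unique l1 (l2.congr' ?_)
    filter_upwards [hr01] with r hr
    rw [← poisson_re N hN hr.1 hr.2 hz, intervalIntegral.integral_of_le (by linarith),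
      MeasureTheory.integral_Ioc_eq_integral_Ioo]
  have main := tendsto_setIntegral_peak_smul_of_integrableOn_of_tendsto
    (μ := MeasureTheory.volume) (s := s) (φ := pK) (g := g) (a := l) (x₀ := 0)
    (l := 𝓝[ball (0 : ℂ) 1] 1) measurableSet_Ioo (t := s) measurableSet_Ioo subset_rfl
    self_mem_nhdsWithin (by simp [hs]) ?_ pK_unif ?_ ?_ hgi
    (hgl.mono_left nhdsWithin_le_nhds)
  · refine main.congr' ?_
    filter_upwards [self_mem_nhdsWithin] with z hz using (hrep z hz).symm
  · filter_upwards [self_mem_nhdsWithin] with z hz t _ using pK_nonneg hz t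
  · refine tendsto_const_nhds.congr' ?_
    filter_upwards [self_mem_nhdsWithin] with z hz
    rw [← pK_integral hz, intervalIntegral.integral_of_le (by linarith),
      MeasureTheory.integral_Ioc_eq_integral_Ioo]
  · filter_upwards [self_mem_nhdsWithin] with z hz
    exact (pK_continuous hz).aestronglyMeasurable

lemma deriv_small (N : ℂ → ℂ) (hN : DifferentiableOn ℂ N (ball (0 : ℂ) 1)) (l : ℝ)
    (hl : Tendsto (fun z => (N z).re) (𝓝[ball (0 : ℂ) 1] 1) (𝓝 l)) {η : ℝ} (hη : 0 < η) :
    ∃ δ > 0, ∀ z ∈ ball (0 : ℂ) 1, ‖z - 1‖ < δ → ‖deriv N z‖ ≤ η / (1 - ‖z‖) := by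
  set ε : ℝ := η / (2 * Real.exp 1 ^ 2) with hε
  have hε0 : 0 < ε := by positivity
  obtain ⟨δ0, hδ0, hδ⟩ : ∃ δ0 > 0, ∀ z ∈ ball (0 : ℂ) 1, ‖z - 1‖ < δ0 → |(N z).re - l| < ε := by
    have := Metric.tendsto_nhdsWithin_nhds.1 hl ε hε0
    obtain ⟨d, hd, h⟩ := this
    refine ⟨d, hd, fun z hz hz1 => ?_⟩
    have := h hz (by simpa [dist_eq_norm] using hz1)
    simpa [Real.dist_eq] using this
  refine ⟨δ0 / 2, by positivity, fun z hz hz1 => ?_⟩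
  have hzn : ‖z‖ < 1 := by simpa using hz
  set R : ℝ := (1 - ‖z‖) / 2 with hR
  have hR0 : 0 < R := by rw [hR]; linarith
  have hRle : R ≤ ‖z - 1‖ := by
    have := norm_sub_norm_le (1 : ℂ) z
    rw [norm_one, norm_sub_rev] at this
    rw [hR]; linarith [norm_nonneg (z - 1)]
  have hsub : closedBall z R ⊆ ball (0 : ℂ) 1 := by
    intro p hp
    have hp' : ‖p - z‖ ≤ R := by simpa [dist_eq_norm] using hp
    have := norm_add_le (p - z) z
    rw [sub_add_cancel] at this
    simp only [mem_ball, dist_zero_right]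
    rw [hR] at hp'
    linarith
  have hclose : ∀ p ∈ closedBall z R, |(N p).re - l| < ε := by
    intro p hp
    refine hδ p (hsub hp) ?_
    have hp' : ‖p - z‖ ≤ R := by simpa [dist_eq_norm] using hp
    have := norm_add_le (p - z) (z - 1)
    rw [sub_add_sub_cancel] at this
    linarith
  set h : ℂ → ℂ := fun p => Complex.exp ((N p - l) / ε) with hh
  have hnorm : ∀ p, ‖h p‖ = Real.exp (((N p).re - l) / ε) := by
    intro p
    rw [hh, Complex.norm_exp, Complex.div_ofReal_re]; simp
  have hub : ∀ p ∈ closedBall z R, ‖h p‖ ≤ Real.exp 1 := by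
    intro p hp
    rw [hnorm]
    apply Real.exp_le_exp.2
    rw [div_le_one hε0]
    exact (abs_lt.1 (hclose p hp)).2.le
  have hlb : (Real.exp 1)⁻¹ ≤ ‖h z‖ := by
    rw [hnorm, ← Real.exp_neg]
    apply Real.exp_le_exp.2
    rw [le_div_iff₀ hε0]
    have := (abs_lt.1 (hclose z (mem_closedBall_self hR0.le))).1
    linarith
  have hNd : HasDerivAt N (deriv N z) z :=
    (hN.differentiableAt (isOpen_ball.mem_nhds hz)).hasDerivAt
  have hhd : HasDerivAt h (h z * (deriv N z / ε)) z := by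
    have := ((hNd.sub_const (l : ℂ)).div_const (ε : ℂ)).cexp
    exact this
  have hdc : DiffContOnCl ℂ h (ball z R) := by
    apply DifferentiableOn.diffContOnCl
    rw [closure_ball _ hR0.ne']
    have := hN.mono hsub
    rw [hh]
    fun_prop
  have hcau := Complex.norm_deriv_le_of_forall_mem_sphere_norm_le hR0 hdc
    (fun p hp => hub p (sphere_subset_closedBall hp))
  rw [hhd.deriv, norm_mul, norm_div, Complex.norm_real, Real.norm_eq_abs, abs_of_pos hε0] at hcau
  have he : 0 < Real.exp 1 := Real.exp_pos 1
  have h1 : (Real.exp 1)⁻¹ * (‖deriv N z‖ / ε) ≤ Real.exp 1 / R :=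
    le_trans (mul_le_mul_of_nonneg_right hlb (by positivity)) hcau
  have h2 : ‖deriv N z‖ ≤ Real.exp 1 / R * (ε * Real.exp 1) := by
    have := mul_le_mul_of_nonneg_right h1 (by positivity : 0 ≤ ε * Real.exp 1)
    calc ‖deriv N z‖ = (Real.exp 1)⁻¹ * (‖deriv N z‖ / ε) * (ε * Real.exp 1) := by
          field_simp
      _ ≤ _ := this
  refine h2.trans (le_of_eq ?_)
  rw [hR, hε]
  have : 1 - ‖z‖ ≠ 0 := by linarith
  field_simp

lemma arg_pos {t : ℝ} (h0 : 0 < t) (h1 : t < Real.pi) :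
    Complex.arg (1 - Complex.exp (t * Complex.I)) = (t - Real.pi) / 2 := by
  have e : (1 - Complex.exp (t * Complex.I)) = ((2 * Real.sin (t / 2) : ℝ) : ℂ) *
      (Complex.cos (((t - Real.pi) / 2 : ℝ) : ℂ) + Complex.sin (((t - Real.pi) / 2 : ℝ) : ℂ) * Complex.I) := by
    rw [← Complex.ofReal_cos, ← Complex.ofReal_sin, Complex.exp_mul_I, ← Complex.ofReal_cos,
      ← Complex.ofReal_sin]
    have e1 : (t - Real.pi) / 2 = t / 2 - Real.pi / 2 := by ring
    have e2 : t = 2 * (t / 2) := by ring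
    rw [e1, Real.cos_sub_pi_div_two, Real.sin_sub_pi_div_two]
    have c2 : Real.cos t = 1 - 2 * Real.sin (t / 2) ^ 2 := by
      conv_lhs => rw [e2, Real.cos_two_mul, Real.cos_sq']
      ring
    have s2 : Real.sin t = 2 * Real.sin (t / 2) * Real.cos (t / 2) := by
      conv_lhs => rw [e2, Real.sin_two_mul]
    rw [c2, s2]
    push_cast
    ring
  rw [e, Complex.arg_mul_cos_add_sin_mul_I]
  · have := Real.sin_pos_of_pos_of_lt_pi (x := t / 2) (by linarith) (by linarith)
    positivity
  · constructor <;> linarith [Real.pi_pos]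

lemma arg_neg' {t : ℝ} (h0 : t < 0) (h1 : -Real.pi < t) :
    Complex.arg (1 - Complex.exp (t * Complex.I)) = (t + Real.pi) / 2 := by
  have e : (1 - Complex.exp (t * Complex.I)) = ((2 * Real.sin (-t / 2) : ℝ) : ℂ) *
      (Complex.cos (((t + Real.pi) / 2 : ℝ) : ℂ) + Complex.sin (((t + Real.pi) / 2 : ℝ) : ℂ) * Complex.I) := by
    rw [← Complex.ofReal_cos, ← Complex.ofReal_sin, Complex.exp_mul_I, ← Complex.ofReal_cos,
      ← Complex.ofReal_sin]
    have e1 : (t + Real.pi) / 2 = t / 2 + Real.pi / 2 := by ring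
    have e2 : t = 2 * (t / 2) := by ring
    have e3 : -t / 2 = -(t / 2) := by ring
    rw [e1, e3, Real.cos_add_pi_div_two, Real.sin_add_pi_div_two, Real.sin_neg]
    have c2 : Real.cos t = 1 - 2 * Real.sin (t / 2) ^ 2 := by
      conv_lhs => rw [e2, Real.cos_two_mul, Real.cos_sq']
      ring
    have s2 : Real.sin t = 2 * Real.sin (t / 2) * Real.cos (t / 2) := by
      conv_lhs => rw [e2, Real.sin_two_mul]
    rw [c2, s2]
    push_cast
    ring
  rw [e, Complex.arg_mul_cos_add_sin_mul_I]
  · have := Real.sin_pos_of_pos_of_lt_pi (x := -t / 2) (by linarith) (by linarith)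
    positivity
  · constructor <;> linarith [Real.pi_pos]

lemma one_sub_re_pos {z : ℂ} (hz : z ∈ ball (0 : ℂ) 1) : 0 < (1 - z).re := by
  have : ‖z‖ < 1 := by simpa using hz
  have := Complex.re_le_norm z
  simp; linarith

lemma polar_mem {r : ℝ} (hr : r ∈ Ioo (0 : ℝ) 1) (t : ℝ) :
    (r : ℂ) * Complex.exp (t * Complex.I) ∈ ball (0 : ℂ) 1 :=
  mul_mem_unit hr.1.le hr.2 (by simp [Complex.norm_exp_ofReal_mul_I])

lemma re_bounded (M : ℂ → ℂ)
    (hv : ∀ r ∈ Ioo (0 : ℝ) 1, Monotone fun t : ℝ => (M (r * Complex.exp (t * Complex.I))).re + t)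
    (B : ℝ → ℝ)
    (hB : ∀ t : ℝ, Tendsto (fun r : ℝ => (M (r * Complex.exp (t * Complex.I))).re + t)
      (𝓝[<] 1) (𝓝 (B t))) :
    ∃ C : ℝ, ∀ᶠ r : ℝ in 𝓝[<] (1 : ℝ), ∀ t : ℝ,
      |(M (r * Complex.exp (t * Complex.I))).re| ≤ C := by
  refine ⟨|B 0| + |B (2 * Real.pi)| + 1 + 2 * Real.pi, ?_⟩
  have hpi := Real.pi_pos
  have h1 := (hB 0).eventually (lt_mem_nhds (show B 0 - 1 < B 0 by linarith))
  have h2 := (hB (2 * Real.pi)).eventually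
    (gt_mem_nhds (show B (2 * Real.pi) < B (2 * Real.pi) + 1 by linarith))
  filter_upwards [h1, h2, Ioo_mem_nhdsLT one_pos] with r hr1 hr2 hr t
  obtain ⟨m, hm, -⟩ := existsUnique_add_zsmul_mem_Ico Real.two_pi_pos t 0
  simp only [zsmul_eq_mul, zero_add] at hm
  have hper : Complex.exp (((t + m * (2 * Real.pi) : ℝ) : ℂ) * Complex.I)
      = Complex.exp (t * Complex.I) := by
    rw [Complex.exp_eq_exp_iff_exists_int]
    exact ⟨m, by push_cast; ring⟩
  rw [← hper]
  set t' := t + m * (2 * Real.pi)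
  have a1 := hv r hr hm.1
  have a2 := hv r hr hm.2.le
  simp only at a1 a2
  have b1 := neg_abs_le (B 0)
  have b2 := le_abs_self (B (2 * Real.pi))
  have b3 := abs_nonneg (B 0)
  have b4 := abs_nonneg (B (2 * Real.pi))
  rw [abs_le]
  constructor <;> linarith [hm.1, hm.2]

lemma N_limit (M : ℂ → ℂ) (hM : DifferentiableOn ℂ M (ball (0 : ℂ) 1))
    (hv : ∀ r ∈ Ioo (0 : ℝ) 1, Monotone fun t : ℝ => (M (r * Complex.exp (t * Complex.I))).re + t)
    (B : ℝ → ℝ)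
    (hB : ∀ t : ℝ, Tendsto (fun r : ℝ => (M (r * Complex.exp (t * Complex.I))).re + t)
      (𝓝[<] 1) (𝓝 (B t))) (bm bp : ℝ) (hbm : Tendsto B (𝓝[<] 0) (𝓝 bm))
    (hbp : Tendsto B (𝓝[>] 0) (𝓝 bp)) :
    Tendsto (fun z => (M z - Complex.I * ((bp - bm) / Real.pi : ℝ) * Complex.log (1 - z)).re)
      (𝓝[ball (0 : ℂ) 1] 1) (𝓝 ((bm + bp) / 2)) := by
  have hpi := Real.pi_pos
  obtain ⟨C, hC⟩ := re_bounded M hv B hB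
  set κ : ℝ := (bp - bm) / Real.pi with hκ
  have hre : ∀ z, (M z - Complex.I * (κ : ℝ) * Complex.log (1 - z)).re
      = (M z).re + κ * Complex.arg (1 - z) := by
    intro z
    simp [Complex.log_im]
  have hargb : ∀ z ∈ ball (0 : ℂ) 1, |Complex.arg (1 - z)| ≤ Real.pi / 2 := fun z hz =>
    (Complex.abs_arg_lt_pi_div_two_iff.2 (Or.inl (one_sub_re_pos hz))).le
  refine poisson_limit (fun z => M z - Complex.I * (κ : ℝ) * Complex.log (1 - z)) ?_
    (C + |κ| * (Real.pi / 2)) ?_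
    (fun t => B t - t + κ * Complex.arg (1 - Complex.exp (t * Complex.I))) ?_ _ ?_
  · refine hM.sub (DifferentiableOn.const_mul ?_ _)
    refine DifferentiableOn.clog (by fun_prop) ?_
    intro z hz
    exact Or.inl (one_sub_re_pos hz)
  · filter_upwards [hC, Ioo_mem_nhdsLT one_pos] with r hr hr01 t
    rw [hre]
    refine (abs_add_le _ _).trans (add_le_add (hr t) ?_)
    rw [abs_mul]
    exact mul_le_mul_of_nonneg_left (hargb _ (polar_mem hr01 t)) (abs_nonneg _)
  · intro t ht ht0
    simp only [hre]
    refine Tendsto.add ?_ (Tendsto.const_mul _ ?_)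
    · have := (hB t).sub_const t
      simpa using this
    · have hcos : Real.cos t < 1 := by
        rcases lt_or_eq_of_le (Real.cos_le_one t) with h | h
        · exact h
        · exact absurd ((Real.cos_eq_one_iff_of_lt_of_lt (by linarith [ht.1]) (by linarith [ht.2])).1 h) ht0
      have hsp : (1 - Complex.exp (t * Complex.I)) ∈ Complex.slitPlane := by
        left
        simp [Complex.exp_ofReal_mul_I_re, hcos]
      have h1 : ContinuousAt (fun r : ℝ => 1 - (r : ℂ) * Complex.exp (t * Complex.I)) 1 := by
        fun_prop
      have h2 : ContinuousAt Complex.arg (1 - ((1 : ℝ) : ℂ) * Complex.exp (t * Complex.I)) := by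
        apply Complex.continuousAt_arg
        simpa using hsp
      have h3 := (ContinuousAt.comp (f := fun r : ℝ => 1 - (r : ℂ) * Complex.exp (t * Complex.I))
        h2 h1).tendsto
      simp only [Function.comp_def, Complex.ofReal_one, one_mul] at h3
      exact h3.mono_left nhdsWithin_le_nhds
  · rw [← Iio_union_Ioi, nhdsWithin_union]
    refine Tendsto.sup ?_ ?_
    · have h1 : Tendsto (fun t : ℝ => B t - t + κ * ((t + Real.pi) / 2)) (𝓝[<] 0)
          (𝓝 (bm - 0 + κ * ((0 + Real.pi) / 2))) := by
        have : Tendsto (fun t : ℝ => t) (𝓝[<] 0) (𝓝 0) := nhdsWithin_le_nhds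
        exact (hbm.sub this).add (((this.add_const _).div_const _).const_mul _)
      have e : bm - 0 + κ * ((0 + Real.pi) / 2) = (bm + bp) / 2 := by
        rw [hκ]; field_simp; ring
      rw [e] at h1
      refine h1.congr' ?_
      filter_upwards [Ioo_mem_nhdsLT (show -Real.pi < 0 by linarith)] with t ht
      rw [arg_neg' ht.2 ht.1]
    · have h1 : Tendsto (fun t : ℝ => B t - t + κ * ((t - Real.pi) / 2)) (𝓝[>] 0)
          (𝓝 (bp - 0 + κ * ((0 - Real.pi) / 2))) := by
        have : Tendsto (fun t : ℝ => t) (𝓝[>] 0) (𝓝 0) := nhdsWithin_le_nhds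
        exact (hbp.sub this).add (((this.sub_const _).div_const _).const_mul _)
      have e : bp - 0 + κ * ((0 - Real.pi) / 2) = (bm + bp) / 2 := by
        rw [hκ]; field_simp; ring
      rw [e] at h1
      refine h1.congr' ?_
      filter_upwards [Ioo_mem_nhdsGT hpi] with t ht
      rw [arg_pos ht.1 ht.2]

lemma radial_tendsto : Tendsto (fun r : ℝ => (r : ℂ)) (𝓝[<] 1) (𝓝[ball (0 : ℂ) 1] 1) := by
  refine tendsto_nhdsWithin_iff.2 ⟨?_, ?_⟩
  · have : Continuous fun r : ℝ => (r : ℂ) := by fun_prop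
    have h := this.tendsto 1
    rw [Complex.ofReal_one] at h
    exact h.mono_left nhdsWithin_le_nhds
  · filter_upwards [Ioo_mem_nhdsLT one_pos] with r hr
    simpa using polar_mem hr 0

lemma mid_value (M : ℂ → ℂ) (hM : DifferentiableOn ℂ M (ball (0 : ℂ) 1))
    (hv : ∀ r ∈ Ioo (0 : ℝ) 1, Monotone fun t : ℝ => (M (r * Complex.exp (t * Complex.I))).re + t)
    (B : ℝ → ℝ)
    (hB : ∀ t : ℝ, Tendsto (fun r : ℝ => (M (r * Complex.exp (t * Complex.I))).re + t)
      (𝓝[<] 1) (𝓝 (B t))) (bm bp : ℝ) (hbm : Tendsto B (𝓝[<] 0) (𝓝 bm))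
    (hbp : Tendsto B (𝓝[>] 0) (𝓝 bp)) : B 0 = (bm + bp) / 2 := by
  have h := (N_limit M hM hv B hB bm bp hbm hbp).comp radial_tendsto
  refine tendsto_nhds_unique ((hB 0).congr' ?_) h
  filter_upwards [Ioo_mem_nhdsLT one_pos] with r hr
  have : Complex.arg (1 - (r : ℂ)) = 0 := by
    rw [← Complex.ofReal_one, ← Complex.ofReal_sub]
    exact Complex.arg_ofReal_of_nonneg (by linarith [hr.2])
  simp [Complex.log_im, this]

lemma im_tendsto (M : ℂ → ℂ) (hM : DifferentiableOn ℂ M (ball (0 : ℂ) 1))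
    (hv : ∀ r ∈ Ioo (0 : ℝ) 1, Monotone fun t : ℝ => (M (r * Complex.exp (t * Complex.I))).re + t)
    (B : ℝ → ℝ)
    (hB : ∀ t : ℝ, Tendsto (fun r : ℝ => (M (r * Complex.exp (t * Complex.I))).re + t)
      (𝓝[<] 1) (𝓝 (B t))) (bm bp : ℝ) (hbm : Tendsto B (𝓝[<] 0) (𝓝 bm))
    (hbp : Tendsto B (𝓝[>] 0) (𝓝 bp)) {X : Type*} (F : Filter X) (z : X → ℂ)
    (hz : Tendsto z F (𝓝[ball (0 : ℂ) 1] 1)) (ψ : ℝ) (hψ : ψ ∈ Ioo bm bp)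
    (hzψ : Tendsto (fun x => (M (z x)).re) F (𝓝 ψ)) :
    Tendsto (fun x => (M (z x)).im) F atBot := by
  have hpi := Real.pi_pos
  have hlim := N_limit M hM hv B hB bm bp hbm hbp
  set κ : ℝ := (bp - bm) / Real.pi with hκ
  have hκ0 : 0 < κ := by
    have := hψ.1.trans hψ.2
    exact div_pos (by linarith) hpi
  set N : ℂ → ℂ := fun z => M z - Complex.I * (κ : ℝ) * Complex.log (1 - z) with hNdef
  have hN : DifferentiableOn ℂ N (ball (0 : ℂ) 1) := by
    refine hM.sub (DifferentiableOn.const_mul ?_ _)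
    refine DifferentiableOn.clog (by fun_prop) ?_
    intro z hz
    exact Or.inl (one_sub_re_pos hz)
  have hre : ∀ z, (N z).re = (M z).re + κ * Complex.arg (1 - z) := by
    intro z
    simp [hNdef, Complex.log_im]
  have him : ∀ z, (M z).im = (N z).im + κ * Real.log ‖1 - z‖ := by
    intro z
    simp [hNdef, Complex.log_re]
  -- limit of the argument
  set α : ℝ := ((bm + bp) / 2 - ψ) / κ with hα
  have harg : Tendsto (fun x => Complex.arg (1 - z x)) F (𝓝 α) := by
    have h1 := ((hlim.comp hz).sub hzψ).div_const κ
    refine h1.congr fun x => ?_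
    simp only [Function.comp_apply]
    have := hre (z x)
    rw [this]
    field_simp
    ring
  have hαlt : |α| < Real.pi / 2 := by
    have h1 : |(bm + bp) / 2 - ψ| < (bp - bm) / 2 := by
      rw [abs_lt]; constructor <;> linarith [hψ.1, hψ.2]
    rw [hα, abs_div, abs_of_pos hκ0, div_lt_iff₀ hκ0]
    refine h1.trans_eq ?_
    rw [hκ]; field_simp
  have hcos : 0 < Real.cos α := Real.cos_pos_of_mem_Ioo ⟨by linarith [(abs_lt.1 hαlt).1], (abs_lt.1 hαlt).2⟩
  set c : ℝ := Real.cos α / 2 with hc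
  have hc0 : 0 < c := by positivity
  have hcosev : ∀ᶠ x in F, c < Real.cos (Complex.arg (1 - z x)) :=
    ((Real.continuous_cos.tendsto α).comp harg).eventually (lt_mem_nhds (by linarith))
  obtain ⟨δ, hδ0, hδ⟩ := deriv_small N hN _ hlim (show (0:ℝ) < κ / 2 by positivity)
  set η : ℝ := κ / 2 with hη
  have hη0 : 0 < η := by positivity
  set r0 : ℝ := max (1 - δ / 2) (1 / 2) with hr0
  have hr0lt : r0 < 1 := max_lt (by linarith) (by norm_num)
  have hr0pos : 0 < r0 := lt_of_lt_of_le (by norm_num) (le_max_right _ _)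
  have hball : ∀ r ∈ Ico r0 1, ((r : ℂ) ∈ ball (0 : ℂ) 1 ∧ ‖(r : ℂ) - 1‖ < δ) := by
    intro r hr
    refine ⟨by simpa using polar_mem ⟨hr0pos.trans_le hr.1, hr.2⟩ 0, ?_⟩
    rw [← Complex.ofReal_one, ← Complex.ofReal_sub, Complex.norm_real, Real.norm_eq_abs,
      abs_of_nonpos (by linarith [hr.2])]
    have := (le_max_left (1 - δ / 2) (1 / 2)).trans hr.1
    linarith
  have hder : ∀ r ∈ Ico r0 1, HasDerivAt (fun x : ℝ => (N x).im + η * Real.log (1 - x))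
      ((deriv N r).im + η * (-1 / (1 - r))) r := by
    intro r hr
    have h1 : HasDerivAt N (deriv N r) (r : ℂ) :=
      (hN.differentiableAt (isOpen_ball.mem_nhds (hball r hr).1)).hasDerivAt
    have h2 : HasDerivAt (fun x : ℝ => (N x).im) (deriv N r).im r := by
      have := (Complex.imCLM.hasFDerivAt (x := N r)).comp_hasDerivAt r h1.comp_ofReal
      exact this
    have h3 : HasDerivAt (fun x : ℝ => 1 - x) (-1) r := by
      simpa using (hasDerivAt_id r).const_sub 1
    exact h2.add ((h3.log (by linarith [hr.2])).const_mul η)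
  have hanti : AntitoneOn (fun x : ℝ => (N x).im + η * Real.log (1 - x)) (Ico r0 1) := by
    refine antitoneOn_of_deriv_nonpos (convex_Ico _ _)
      (fun r hr => (hder r hr).continuousAt.continuousWithinAt)
      (fun r hr => (hder r (interior_subset hr)).differentiableAt.differentiableWithinAt) ?_
    intro r hr'
    have hr := interior_subset hr'
    rw [(hder r hr).deriv]
    have h1 := hδ r (hball r hr).1 (hball r hr).2
    have h2 := (Complex.im_le_norm (deriv N r)).trans h1
    rw [Complex.norm_real, Real.norm_eq_abs, abs_of_pos (hr0pos.trans_le hr.1)] at h2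
    have : η * (-1 / (1 - r)) = -(η / (1 - r)) := by ring
    rw [this]; linarith
  set K : ℝ := 2 / c with hK
  have hK0 : 0 < K := by positivity
  have hz1 : Tendsto z F (𝓝 1) := hz.mono_right nhdsWithin_le_nhds
  have hzb : ∀ᶠ x in F, z x ∈ ball (0 : ℂ) 1 := (tendsto_nhdsWithin_iff.1 hz).2
  have hnear : ∀ ε > 0, ∀ᶠ x in F, ‖z x - 1‖ < ε := by
    intro ε hε
    have := hz1.eventually (ball_mem_nhds 1 hε)
    simpa [dist_eq_norm] using this
  have hnorm : Tendsto (fun x => 1 - ‖z x‖) F (𝓝[>] 0) := by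
    refine tendsto_nhdsWithin_iff.2 ⟨?_, ?_⟩
    · have := (hz1.norm).const_sub 1
      simpa using this
    · filter_upwards [hzb] with x hx
      have : ‖z x‖ < 1 := by simpa using hx
      simp [this]
  have hlog : Tendsto (fun x => Real.log (1 - ‖z x‖)) F atBot :=
    Real.tendsto_log_nhdsGT_zero.comp hnorm
  set D : ℝ := (N r0).im + η * Real.log (1 - r0) + η * (K + 1) + κ * Real.log K with hD
  have hup : Tendsto (fun x => D + η * Real.log (1 - ‖z x‖)) F atBot :=
    tendsto_atBot_add_const_left _ _ (hlog.const_mul_atBot hη0)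
  refine tendsto_atBot_mono' F ?_ hup
  filter_upwards [hcosev, hzb, hnear c hc0, hnear δ hδ0, hnear (1 - r0) (by linarith)] with
    x h1 h2 h3 h4 h5
  set p := z x with hp
  set r := ‖p‖ with hr
  have hr1 : r < 1 := by simpa using h2
  have hrr0 : r0 < r := by
    have := norm_sub_norm_le (1 : ℂ) p
    rw [norm_one, norm_sub_rev] at this
    linarith
  have hrI : r ∈ Ico r0 1 := ⟨hrr0.le, hr1⟩
  -- the Stolz estimate
  set w := 1 - p with hw
  have hwn : ‖w‖ = ‖p - 1‖ := norm_sub_rev _ _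
  have hwpos : 0 < ‖w‖ := by
    rw [norm_pos_iff]
    intro h
    have := one_sub_re_pos h2
    rw [← hw, h] at this
    simp at this
  have hwK : ‖w‖ ≤ K * (1 - r) := by
    have a1 : c * ‖w‖ ≤ w.re := by
      rw [← Complex.norm_mul_cos_arg w, mul_comm]
      exact mul_le_mul_of_nonneg_left h1.le hwpos.le
    have a2 : 2 * w.re = 1 - r ^ 2 + ‖w‖ ^ 2 := by
      rw [hr, Complex.sq_norm, Complex.sq_norm, hw, Complex.normSq_apply, Complex.normSq_apply]
      simp
      ring
    have a3 : ‖w‖ ^ 2 ≤ c * ‖w‖ := by nlinarith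
    have a4 : c * ‖w‖ ≤ 2 * (1 - r) := by nlinarith [norm_nonneg p]
    rw [hK, div_mul_eq_mul_div, le_div_iff₀ hc0]
    linarith
  -- move from the radius to the point
  have hmove : ‖N p - N r‖ ≤ η / (1 - r) * ‖p - r‖ := by
    refine Convex.norm_image_sub_le_of_norm_deriv_le (s := closedBall 0 r ∩ ball 1 δ) ?_ ?_
      ((convex_closedBall _ _).inter (convex_ball _ _)) ?_ ?_
    · intro q hq
      refine hN.differentiableAt (isOpen_ball.mem_nhds ?_)
      exact closedBall_subset_ball hr1 hq.1
    · intro q hq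
      have hq1 : ‖q‖ ≤ r := by simpa using hq.1
      refine (hδ q (closedBall_subset_ball hr1 hq.1) (by simpa [dist_eq_norm] using hq.2)).trans ?_
      apply div_le_div_of_nonneg_left hη0.le (by linarith) (by linarith)
    · refine ⟨?_, ?_⟩
      · simp [hr]
      · simpa [dist_eq_norm] using (hball r hrI).2
    · refine ⟨by simp [hr], by simpa [dist_eq_norm] using h4⟩
  have hpr : ‖p - r‖ ≤ (K + 1) * (1 - r) := by
    have a1 : p - r = (p - 1) + (1 - r) := by ring
    have a2 : ‖(1 : ℂ) - r‖ = 1 - r := by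
      rw [← Complex.ofReal_one, ← Complex.ofReal_sub, Complex.norm_real, Real.norm_eq_abs,
        abs_of_nonneg (by linarith)]
    rw [a1]
    refine (norm_add_le _ _).trans ?_
    rw [a2, ← hwn]
    linarith
  have hmove2 : ‖N p - N r‖ ≤ η * (K + 1) := by
    refine hmove.trans ?_
    have h1r : 0 < 1 - r := by linarith
    calc η / (1 - r) * ‖p - r‖ ≤ η / (1 - r) * ((K + 1) * (1 - r)) := by gcongr
      _ = η * (K + 1) := by field_simp
  have hrad := hanti ⟨le_refl r0, hr0lt⟩ hrI hrr0.le
  simp only at hrad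
  have hNp : (N p).im ≤ (N r).im + η * (K + 1) := by
    have := (Complex.im_le_norm (N p - N r)).trans hmove2
    rw [Complex.sub_im] at this
    linarith
  have hlogw : Real.log ‖w‖ ≤ Real.log K + Real.log (1 - r) := by
    rw [← Real.log_mul hK0.ne' (by linarith)]
    exact Real.log_le_log hwpos hwK
  rw [him p]
  have := mul_le_mul_of_nonneg_left hlogw hκ0.le
  have e : κ = 2 * η := by rw [hη]; ring
  rw [hD]
  have e2 : κ * (Real.log K + Real.log (1 - r)) = κ * Real.log K + 2 * (η * Real.log (1 - r)) := by
    rw [mul_add, e]; ring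
  rw [e2] at this
  linarith

/-- The logarithmic coordinate map on the left half plane. -/
noncomputable def logMap (T : ℝ) (L : ℂ → ℂ) (ζ : ℂ) : ℂ :=
  (1 - Complex.I * T) * (ζ + L (Complex.exp ζ))

lemma exp_mem {ζ : ℂ} (h : ζ.re < 0) : Complex.exp ζ ∈ ball (0 : ℂ) 1 := by
  simp [Complex.norm_exp, h]

lemma logMap_hasDerivAt (T : ℝ) (L : ℂ → ℂ) (hL : DifferentiableOn ℂ L (ball (0 : ℂ) 1))
    {ζ : ℂ} (h : ζ.re < 0) :
    HasDerivAt (logMap T L)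
      ((1 - Complex.I * T) * (1 + Complex.exp ζ * deriv L (Complex.exp ζ))) ζ := by
  have h1 : HasDerivAt L (deriv L (Complex.exp ζ)) (Complex.exp ζ) :=
    (hL.differentiableAt (isOpen_ball.mem_nhds (exp_mem h))).hasDerivAt
  have h2 := h1.comp ζ (Complex.hasDerivAt_exp ζ)
  have h3 := ((hasDerivAt_id ζ).add h2).const_mul (1 - Complex.I * (T : ℂ))
  rw [mul_comm (Complex.exp ζ)]
  exact h3

lemma logMap_inj (T : ℝ) (L : ℂ → ℂ) (hL : DifferentiableOn ℂ L (ball (0 : ℂ) 1))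
    (hQ : ∀ z ∈ ball (0 : ℂ) 1, 0 < ((1 - Complex.I * T) * (1 + z * deriv L z)).re)
    {a b : ℂ} (ha : a.re < 0) (hb : b.re < 0) (h : logMap T L a = logMap T L b) : a = b := by
  by_contra hab
  set d := b - a with hd
  have hd0 : d ≠ 0 := sub_ne_zero.2 (Ne.symm hab)
  have hmem : ∀ s ∈ Icc (0 : ℝ) 1, (a + s * d).re < 0 := by
    intro s hs
    have : (a + s * d).re = (1 - s) * a.re + s * b.re := by simp [hd]; ring
    rw [this]
    rcases eq_or_lt_of_le hs.1 with h0 | h0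
    · rw [← h0]; simpa using ha
    · nlinarith [hs.2]
  set q : ℂ → ℂ := fun z => (1 - Complex.I * T) * (1 + z * deriv L z) with hq
  have hder : ∀ s ∈ Icc (0 : ℝ) 1, HasDerivAt
      (fun s : ℝ => (starRingEnd ℂ d * logMap T L (a + s * d)).re)
      (Complex.normSq d * (q (Complex.exp (a + s * d))).re) s := by
    intro s hs
    have h1 : HasDerivAt (fun s : ℂ => a + s * d) d (s : ℂ) := by
      simpa using ((hasDerivAt_id (s : ℂ)).mul_const d).const_add a
    have h2 := (HasDerivAt.comp (h₂ := logMap T L) (h := fun s : ℂ => a + s * d) (s : ℂ)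
      (logMap_hasDerivAt T L hL (hmem s hs)) h1)
    have h3 := (h2.const_mul (starRingEnd ℂ d)).real_of_complex
    have e : (starRingEnd ℂ d * (q (Complex.exp (a + s * d)) * d)).re
        = Complex.normSq d * (q (Complex.exp (a + s * d))).re := by
      rw [← Complex.re_ofReal_mul, Complex.normSq_eq_conj_mul_self]
      congr 1
      ring
    rw [← e]
    exact h3
  have hmono : StrictMonoOn (fun s : ℝ => (starRingEnd ℂ d * logMap T L (a + s * d)).re)
      (Icc 0 1) := by
    refine strictMonoOn_of_deriv_pos (convex_Icc _ _)
      (fun s hs => (hder s hs).continuousAt.continuousWithinAt) ?_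
    intro s hs
    have hs' := interior_subset hs
    rw [(hder s hs').deriv]
    exact mul_pos (Complex.normSq_pos.2 hd0) (hQ _ (exp_mem (hmem s hs')))
  have := hmono (left_mem_Icc.2 zero_le_one) (right_mem_Icc.2 zero_le_one) one_pos
  simp [hd, h] at this

lemma logMap_not_tendsto (T : ℝ) (L : ℂ → ℂ) (hL : DifferentiableOn ℂ L (ball (0 : ℂ) 1))
    (hQ : ∀ z ∈ ball (0 : ℂ) 1, 0 < ((1 - Complex.I * T) * (1 + z * deriv L z)).re)
    {ζ₀ : ℂ} (h0 : ζ₀.re < 0) (t : ℝ)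
    (h : Tendsto (fun x : ℝ => logMap T L (x + t * Complex.I)) (𝓝[<] 0) (𝓝 (logMap T L ζ₀))) :
    False := by
  have hopen : IsOpen {ζ : ℂ | ζ.re < 0} := isOpen_lt Complex.continuous_re continuous_const
  have hdiff : DifferentiableOn ℂ (logMap T L) {ζ : ℂ | ζ.re < 0} := fun ζ hζ =>
    (logMap_hasDerivAt T L hL hζ).differentiableAt.differentiableWithinAt
  have han : AnalyticAt ℂ (logMap T L) ζ₀ := hdiff.analyticAt (hopen.mem_nhds h0)
  have hstrict := han.hasStrictDerivAt
  have hne : deriv (logMap T L) ζ₀ ≠ 0 := by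
    rw [(logMap_hasDerivAt T L hL h0).deriv]
    intro hz
    have := hQ _ (exp_mem h0)
    rw [hz] at this
    simp at this
  have hmap := hstrict.map_nhds_eq hne
  have hV : {ζ : ℂ | ζ.re < ζ₀.re / 2} ∈ 𝓝 ζ₀ :=
    (isOpen_lt Complex.continuous_re continuous_const).mem_nhds (by simp; linarith)
  have himg : logMap T L '' {ζ : ℂ | ζ.re < ζ₀.re / 2} ∈ 𝓝 (logMap T L ζ₀) := by
    rw [← hmap]; exact image_mem_map hV
  have hev := h.eventually himg
  have hev2 : ∀ᶠ x : ℝ in 𝓝[<] (0 : ℝ), x ∈ Ioo (ζ₀.re / 2) 0 := Ioo_mem_nhdsLT (by linarith)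
  obtain ⟨x, ⟨ζ, hζ, hζx⟩, hx⟩ := (hev.and hev2).exists
  have hζ' : ζ.re < ζ₀.re / 2 := hζ
  have := logMap_inj T L hL hQ (a := ζ) (b := x + t * Complex.I) (by linarith)
    (by simpa using hx.2) hζx
  have hre := congrArg Complex.re this
  simp at hre
  linarith [hx.1]

lemma logMap_mono (T : ℝ) (L : ℂ → ℂ) (hL : DifferentiableOn ℂ L (ball (0 : ℂ) 1))
    (hQ : ∀ z ∈ ball (0 : ℂ) 1, 0 < ((1 - Complex.I * T) * (1 + z * deriv L z)).re) (t : ℝ) :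
    MonotoneOn (fun x : ℝ => (logMap T L (x + t * Complex.I)).re) (Iio 0) := by
  have hder : ∀ x ∈ Iio (0 : ℝ), HasDerivAt (fun x : ℝ => (logMap T L (x + t * Complex.I)).re)
      (((1 - Complex.I * T) * (1 + Complex.exp (x + t * Complex.I) *
        deriv L (Complex.exp (x + t * Complex.I)))).re) x := by
    intro x hx
    have h1 : HasDerivAt (fun s : ℂ => s + t * Complex.I) 1 (x : ℂ) := by
      simpa using (hasDerivAt_id (x : ℂ)).add_const (t * Complex.I)
    have h2 := (HasDerivAt.comp (h₂ := logMap T L) (h := fun s : ℂ => s + t * Complex.I) (x : ℂ)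
      (logMap_hasDerivAt T L hL (by simpa using hx)) h1)
    have h3 := h2.real_of_complex
    rw [mul_one] at h3
    exact h3
  refine monotoneOn_of_deriv_nonneg (convex_Iio _)
    (fun s hs => (hder s hs).continuousAt.continuousWithinAt)
    (fun s hs => (hder s (interior_subset hs)).differentiableAt.differentiableWithinAt) ?_
  intro s hs
  have hs' : s ∈ Iio (0 : ℝ) := interior_subset hs
  rw [(hder s hs').deriv]
  exact (hQ _ (exp_mem (by simpa using hs'))).le

lemma logMap_re (T : ℝ) (L : ℂ → ℂ) (x t : ℝ) : (logMap T L (x + t * Complex.I)).re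
    = ((1 - Complex.I * T) * L ((Real.exp x : ℝ) * Complex.exp (t * Complex.I))).re + x + T * t := by
  rw [logMap, Complex.exp_add, ← Complex.ofReal_exp]
  simp
  ring

lemma logMap_im (T : ℝ) (L : ℂ → ℂ) (x t : ℝ) : (logMap T L (x + t * Complex.I)).im
    = ((L ((Real.exp x : ℝ) * Complex.exp (t * Complex.I))).im
      - T * (L ((Real.exp x : ℝ) * Complex.exp (t * Complex.I))).re) + t - T * x := by
  rw [logMap, Complex.exp_add, ← Complex.ofReal_exp]
  simp
  ring

lemma mean_zero (W : ℂ → ℂ) (hW : DifferentiableOn ℂ W (ball (0 : ℂ) 1)) (hW0 : W 0 = 0)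
    {r : ℝ} (h0 : 0 < r) (h1 : r < 1) (a : ℝ) :
    ∫ θ in (0 : ℝ)..(2 * Real.pi), (W (r * Complex.exp ((θ + a : ℝ) * Complex.I))).re = 0 := by
  have hpi := Real.pi_pos
  have hsub : closedBall (0 : ℂ) r ⊆ ball (0 : ℂ) 1 := closedBall_subset_ball h1
  have hdc : DiffContOnCl ℂ W (ball (0 : ℂ) |r|) := by
    apply DifferentiableOn.diffContOnCl
    rw [abs_of_pos h0, closure_ball _ h0.ne']
    exact hW.mono hsub
  have key := hdc.circleAverage
  rw [Real.circleAverage_eq_integral_add a, hW0] at key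
  have key2 := (smul_eq_zero.1 key).resolve_left (by positivity)
  have hcont : Continuous fun θ : ℝ => W (r * Complex.exp ((θ + a : ℝ) * Complex.I)) :=
    hW.continuousOn.comp_continuous (by fun_prop) (fun θ => polar_mem ⟨h0, h1⟩ _)
  have h3 := Complex.reCLM.intervalIntegral_comp_comm (μ := MeasureTheory.volume)
    (hcont.intervalIntegrable 0 (2 * Real.pi))
  have e : ∀ θ : ℝ, W (circleMap 0 r (θ + a)) = W (r * Complex.exp ((θ + a : ℝ) * Complex.I)) := by
    intro θ; simp [circleMap]
  simp_rw [e] at key2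
  rw [key2] at h3
  simpa using h3

lemma no_blowup (T : ℝ) (L : ℂ → ℂ) (hL : DifferentiableOn ℂ L (ball (0 : ℂ) 1))
    (hL0 : L 0 = 0)
    (hQ : ∀ z ∈ ball (0 : ℂ) 1, 0 < ((1 - Complex.I * T) * (1 + z * deriv L z)).re)
    {t1 t2 : ℝ} (h12 : t1 < t2)
    (h : ∀ t ∈ Ioo t1 t2, Tendsto (fun x : ℝ => (logMap T L (x + t * Complex.I)).re)
      (𝓝[<] 0) atTop) : False := by
  have hpi := Real.pi_pos
  set W : ℂ → ℂ := fun z => (1 - Complex.I * T) * L z with hW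
  have hWd : DifferentiableOn ℂ W (ball (0 : ℂ) 1) := hL.const_mul _
  have hW0 : W 0 = 0 := by simp [hW, hL0]
  set Y : ℝ → ℝ → ℝ := fun x t => (W ((Real.exp x : ℝ) * Complex.exp (t * Complex.I))).re with hY
  have hrel : ∀ x t : ℝ, (logMap T L (x + t * Complex.I)).re = Y x t + x + T * t := by
    intro x t; rw [logMap_re]
  have hexp : ∀ x : ℝ, x < 0 → Real.exp x ∈ Ioo (0 : ℝ) 1 := fun x hx =>
    ⟨Real.exp_pos x, by simpa using hx⟩
  have hYc : ∀ x : ℝ, x < 0 → Continuous (Y x) := by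
    intro x hx
    refine Complex.continuous_re.comp ?_
    exact hWd.continuousOn.comp_continuous (by fun_prop) (fun θ => polar_mem (hexp x hx) _)
  -- lower bound
  obtain ⟨C, hC⟩ : ∃ C : ℝ, ∀ t : ℝ, -C ≤ Y (-1) t := by
    have hcomp : IsCompact (closedBall (0 : ℂ) (Real.exp (-1))) := isCompact_closedBall _ _
    have hsub : closedBall (0 : ℂ) (Real.exp (-1)) ⊆ ball (0 : ℂ) 1 :=
      closedBall_subset_ball (hexp (-1) (by norm_num)).2
    obtain ⟨C, hC⟩ := hcomp.exists_bound_of_continuousOn (hWd.continuousOn.mono hsub)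
    refine ⟨C, fun t => ?_⟩
    have := hC ((Real.exp (-1) : ℝ) * Complex.exp (t * Complex.I))
      (by
        rw [mem_closedBall, dist_zero_right, norm_mul, Complex.norm_exp_ofReal_mul_I, mul_one,
          Complex.norm_real, Real.norm_eq_abs, abs_of_pos (Real.exp_pos _)])
    have h2 := (Complex.abs_re_le_norm _).trans this
    exact (abs_le.1 h2).1
  have hlow : ∀ x ∈ Ico (-1 : ℝ) 0, ∀ t : ℝ, 0 ≤ Y x t + (C + 1) := by
    intro x hx t
    have := logMap_mono T L hL hQ t (show (-1 : ℝ) ∈ Iio 0 by simp) (show x ∈ Iio 0 from hx.2) hx.1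
    simp only [hrel] at this
    linarith [hC t, hx.2]
  obtain ⟨xs, hxs⟩ := exists_seq_tendsto (𝓝[<] (0 : ℝ))
  have hxev : ∀ᶠ n in atTop, xs n ∈ Ico (-1 : ℝ) 0 :=
    hxs.eventually (Ico_mem_nhdsLT (by norm_num))
  obtain ⟨n0, hn0⟩ := eventually_atTop.1 hxev
  set ys : ℕ → ℝ := fun n => xs (n + n0) with hys
  have hys0 : Tendsto ys atTop (𝓝[<] (0 : ℝ)) := hxs.comp (tendsto_add_atTop_nat n0)
  have hysm : ∀ n, ys n ∈ Ico (-1 : ℝ) 0 := fun n => hn0 _ (by omega)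
  set d := min (2 * Real.pi) (t2 - t1) with hd
  have hd0 : 0 < d := lt_min (by positivity) (by linarith)
  set g : ℕ → ℝ → ENNReal := fun n θ => ENNReal.ofReal (Y (ys n) (θ + t1) + (C + 1)) with hg
  have hcn : ∀ n, Continuous fun θ => Y (ys n) (θ + t1) + (C + 1) := fun n =>
    ((hYc _ (hysm n).2).comp (by fun_prop)).add continuous_const
  have hgm : ∀ n, Measurable (g n) := fun n =>
    (ENNReal.continuous_ofReal.comp (hcn n)).measurable
  have hintg : ∀ n, ∫⁻ θ in Ioo 0 d, g n θ ≤ ENNReal.ofReal (2 * Real.pi * (C + 1)) := by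
    intro n
    calc ∫⁻ θ in Ioo 0 d, g n θ ≤ ∫⁻ θ in Ioc 0 (2 * Real.pi), g n θ := by
          apply MeasureTheory.lintegral_mono_set
          intro θ hθ
          exact ⟨hθ.1, (hθ.2.trans_le (min_le_left _ _)).le⟩
      _ = ENNReal.ofReal (∫ θ in Ioc 0 (2 * Real.pi), (Y (ys n) (θ + t1) + (C + 1))) := by
          rw [MeasureTheory.ofReal_integral_eq_lintegral_ofReal]
          · exact ((hcn n).integrableOn_Icc).mono_set Ioc_subset_Icc_self
          · exact Eventually.of_forall fun θ => hlow _ (hysm n) _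
      _ = ENNReal.ofReal (2 * Real.pi * (C + 1)) := by
          congr 1
          rw [← intervalIntegral.integral_of_le (by positivity), intervalIntegral.integral_add]
          · have := mean_zero W hWd hW0 (hexp _ (hysm n).2).1 (hexp _ (hysm n).2).2 t1
            simp only [hY]
            rw [this]
            simp
            ring
          · exact ((hYc _ (hysm n).2).comp (by fun_prop : Continuous fun θ : ℝ => θ + t1)).intervalIntegrable _ _
          · simp
  have hfat := MeasureTheory.lintegral_liminf_le (u := atTop) (μ := MeasureTheory.volume.restrict (Ioo 0 d)) hgm
  have htop : ∀ θ ∈ Ioo 0 d, liminf (fun n => g n θ) atTop = ⊤ := by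
    intro θ hθ
    have h1 := (h (θ + t1) ⟨by linarith [hθ.1], by linarith [hθ.2.trans_le (min_le_right (2 * Real.pi) (t2 - t1))]⟩).comp hys0
    have h2 : Tendsto (fun n => Y (ys n) (θ + t1) + (C + 1)) atTop atTop := by
      refine tendsto_atTop_mono ?_ (tendsto_atTop_add_const_right _ (-(T * (θ + t1)) + (C + 1)) h1)
      intro n
      simp only [Function.comp_apply]
      rw [hrel]
      linarith [(hysm n).2]
    exact (ENNReal.tendsto_ofReal_atTop.comp h2).liminf_eq
  have h5 : ∫⁻ θ in Ioo 0 d, liminf (fun n => g n θ) atTop = ⊤ := by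
    rw [MeasureTheory.setLIntegral_congr_fun measurableSet_Ioo htop]
    simp [hd0]
  rw [h5] at hfat
  have h6 : liminf (fun n => ∫⁻ θ in Ioo 0 d, g n θ) atTop ≤ ENNReal.ofReal (2 * Real.pi * (C + 1)) :=
    liminf_le_of_le (by isBoundedDefault) (fun b hb => by
      obtain ⟨n, hn⟩ := hb.exists
      exact hn.trans (hintg n))
  have := hfat.trans h6
  simp at this

lemma spiral_hQ (lam : ℝ) (hlam : lam ∈ Set.Ioo (-(Real.pi / 2)) (Real.pi / 2))
    (f L : ℂ → ℂ) (hf0 : f 0 = 0)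
    (hfp : ∀ z ∈ ball (0 : ℂ) 1, z ≠ 0 →
      0 < (Complex.exp (-(lam : ℂ) * Complex.I) * z * deriv f z / f z).re)
    (hLd : DifferentiableOn ℂ L (ball (0 : ℂ) 1))
    (hLe : ∀ z ∈ ball (0 : ℂ) 1, z ≠ 0 → Complex.exp (L z) = f z / z) :
    ∀ z ∈ ball (0 : ℂ) 1, 0 < ((1 - Complex.I * (Real.tan lam : ℝ)) * (1 + z * deriv L z)).re := by
  intro z hz
  by_cases h0 : z = 0
  · subst h0; simp
  have hcos : 0 < Real.cos lam := Real.cos_pos_of_mem_Ioo hlam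
  have hfe : ∀ w ∈ ball (0 : ℂ) 1, f w = w * Complex.exp (L w) := by
    intro w hw
    by_cases hw0 : w = 0
    · subst hw0; simp [hf0]
    · rw [hLe w hw hw0]; field_simp
  have hev : f =ᶠ[𝓝 z] fun w => w * Complex.exp (L w) := by
    filter_upwards [isOpen_ball.mem_nhds hz] with w hw using hfe w hw
  have hLz : HasDerivAt L (deriv L z) z :=
    (hLd.differentiableAt (isOpen_ball.mem_nhds hz)).hasDerivAt
  have hd : deriv f z = 1 * Complex.exp (L z) + z * (Complex.exp (L z) * deriv L z) := by
    rw [hev.deriv_eq]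
    exact ((hasDerivAt_id z).mul hLz.cexp).deriv
  have hne := Complex.exp_ne_zero (L z)
  have hp := hfp z hz h0
  have e : Complex.exp (-(lam : ℂ) * Complex.I) * z * deriv f z / f z
      = (Real.cos lam : ℝ) * ((1 - Complex.I * (Real.tan lam : ℝ)) * (1 + z * deriv L z)) := by
    have e1 : Complex.exp (-(lam : ℂ) * Complex.I)
        = (Real.cos lam : ℝ) * (1 - Complex.I * (Real.tan lam : ℝ)) := by
      rw [Complex.exp_mul_I, Complex.cos_neg, Complex.sin_neg, Real.tan_eq_sin_div_cos]
      have : (Real.cos lam : ℂ) ≠ 0 := by exact_mod_cast hcos.ne'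
      push_cast at this ⊢
      field_simp
      ring
    rw [hd, hfe z hz, e1]
    field_simp
  rw [e, Complex.re_ofReal_mul] at hp
  exact (mul_pos_iff_of_pos_left hcos).1 hp

lemma sector_mem_iff (lam : ℝ) (hlam : lam ∈ Set.Ioo (-(Real.pi / 2)) (Real.pi / 2))
    (f L : ℂ → ℂ) (hf0 : f 0 = 0)
    (hLe : ∀ z ∈ ball (0 : ℂ) 1, z ≠ 0 → Complex.exp (L z) = f z / z) (ψ s : ℝ) :
    Complex.exp ((ψ : ℂ) * Complex.I + (s : ℂ) * Complex.exp ((lam : ℂ) * Complex.I))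
      ∈ f '' ball (0 : ℂ) 1 ↔
    ∃ ζ : ℂ, ζ.re < 0 ∧ logMap (Real.tan lam) L ζ
      = ((Real.tan lam * ψ + s / Real.cos lam : ℝ) : ℂ) + (ψ : ℂ) * Complex.I := by
  have hcos : 0 < Real.cos lam := Real.cos_pos_of_mem_Ioo hlam
  have hc : (Real.cos lam : ℂ) ≠ 0 := by exact_mod_cast hcos.ne'
  have hfe : ∀ ζ : ℂ, ζ.re < 0 → f (Complex.exp ζ) = Complex.exp (ζ + L (Complex.exp ζ)) := by
    intro ζ h
    rw [Complex.exp_add, hLe _ (exp_mem h) (Complex.exp_ne_zero _)]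
    have := Complex.exp_ne_zero ζ
    field_simp
  have hT : (1 - Complex.I * (Real.tan lam : ℝ)) ≠ (0 : ℂ) := by
    intro h; have := congrArg Complex.re h; simp at this
  have hkey : (1 - Complex.I * (Real.tan lam : ℝ)) *
      ((ψ : ℂ) * Complex.I + (s : ℂ) * Complex.exp ((lam : ℂ) * Complex.I))
      = ((Real.tan lam * ψ + s / Real.cos lam : ℝ) : ℂ) + (ψ : ℂ) * Complex.I := by
    have hsc : (Real.sin lam : ℂ) ^ 2 + (Real.cos lam : ℂ) ^ 2 = 1 := by
      exact_mod_cast Real.sin_sq_add_cos_sq lam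
    rw [Complex.exp_mul_I, Real.tan_eq_sin_div_cos, ← Complex.ofReal_cos, ← Complex.ofReal_sin]
    push_cast only [Complex.ofReal_add, Complex.ofReal_mul, Complex.ofReal_div]
    field_simp
    linear_combination (s : ℂ) * hsc - ((s : ℂ) * (Real.sin lam : ℂ) ^ 2 + (ψ : ℂ) * (Real.sin lam : ℂ)) * Complex.I_sq
  constructor
  · rintro ⟨z, hz, hzw⟩
    have hz0 : z ≠ 0 := by
      rintro rfl
      rw [hf0] at hzw
      exact Complex.exp_ne_zero _ hzw.symm
    have hre : (Complex.log z).re < 0 := by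
      rw [Complex.log_re]
      exact Real.log_neg (norm_pos_iff.2 hz0) (by simpa using hz)
    have h1 := hfe _ hre
    rw [Complex.exp_log hz0, hzw] at h1
    obtain ⟨n, hn⟩ := Complex.exp_eq_exp_iff_exists_int.1 h1
    have hper : Complex.exp (Complex.log z + n * (2 * Real.pi * Complex.I)) = z := by
      rw [Complex.exp_add, Complex.exp_int_mul_two_pi_mul_I, mul_one, Complex.exp_log hz0]
    refine ⟨Complex.log z + n * (2 * Real.pi * Complex.I), by simpa using hre, ?_⟩
    rw [← hkey, hn, logMap, hper]
    ring
  · rintro ⟨ζ, hζ, h⟩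
    refine ⟨Complex.exp ζ, exp_mem hζ, ?_⟩
    rw [hfe ζ hζ]
    rw [← hkey, logMap] at h
    rw [mul_left_cancel₀ hT h]

lemma logMap_im_strictMono (T : ℝ) (L : ℂ → ℂ) (hL : DifferentiableOn ℂ L (ball (0 : ℂ) 1))
    (hQ : ∀ z ∈ ball (0 : ℂ) 1, 0 < ((1 - Complex.I * T) * (1 + z * deriv L z)).re)
    {x : ℝ} (hx : x < 0) :
    StrictMono fun t : ℝ => (logMap T L (x + t * Complex.I)).im := by
  have hder : ∀ t : ℝ, HasDerivAt (fun t : ℝ => (logMap T L (x + t * Complex.I)).im)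
      (((1 - Complex.I * T) * (1 + Complex.exp (x + t * Complex.I) *
        deriv L (Complex.exp (x + t * Complex.I)))).re) t := by
    intro t
    have h1 : HasDerivAt (fun s : ℂ => x + s * Complex.I) Complex.I (t : ℂ) := by
      simpa using ((hasDerivAt_id (t : ℂ)).mul_const Complex.I).const_add (x : ℂ)
    have h2 := (HasDerivAt.comp (h₂ := logMap T L) (h := fun s : ℂ => x + s * Complex.I) (t : ℂ)
      (logMap_hasDerivAt T L hL (by simpa using hx)) h1)
    have h3 := (h2.const_mul (-Complex.I)).real_of_complex
    convert h3 using 1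
    · funext s; simp
    · rw [mul_comm _ Complex.I, ← mul_assoc]; simp
  refine strictMono_of_deriv_pos fun t => ?_
  rw [(hder t).deriv]
  exact hQ _ (exp_mem (by simpa using hx))

lemma logMap_continuousAt (T : ℝ) (L : ℂ → ℂ) (hL : DifferentiableOn ℂ L (ball (0 : ℂ) 1))
    {ζ : ℂ} (h : ζ.re < 0) : ContinuousAt (logMap T L) ζ :=
  (logMap_hasDerivAt T L hL h).continuousAt

lemma logMap_bdry (T : ℝ) (L : ℂ → ℂ) (β : ℝ → ℝ)
    (hβ : ∀ t : ℝ, Tendsto (fun r : ℝ => (L ((r : ℂ) * Complex.exp ((t : ℂ) * Complex.I))).im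
      - T * (L ((r : ℂ) * Complex.exp ((t : ℂ) * Complex.I))).re + t) (𝓝[<] 1) (𝓝 (β t)))
    (t : ℝ) : Tendsto (fun x : ℝ => (logMap T L (x + t * Complex.I)).im) (𝓝[<] 0) (𝓝 (β t)) := by
  have h1 : Tendsto Real.exp (𝓝[<] 0) (𝓝[<] 1) := by
    refine tendsto_nhdsWithin_iff.2 ⟨?_, ?_⟩
    · have := (Real.continuous_exp.tendsto 0).mono_left (nhdsWithin_le_nhds (s := Iio (0 : ℝ)))
      simpa using this
    · filter_upwards [self_mem_nhdsWithin] with x hx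
      simpa using hx
  have h2 := (hβ t).comp h1
  have h3 : Tendsto (fun x : ℝ => T * x) (𝓝[<] 0) (𝓝 0) := by
    have := ((continuous_const_mul T).tendsto 0).mono_left (nhdsWithin_le_nhds (s := Iio (0 : ℝ)))
    simpa using this
  have h4 := h2.sub h3
  rw [sub_zero] at h4
  refine h4.congr fun x => ?_
  rw [logMap_im]
  rfl

lemma beta_periodic (T : ℝ) (L : ℂ → ℂ) (β : ℝ → ℝ)
    (hβ : ∀ t : ℝ, Tendsto (fun r : ℝ => (L ((r : ℂ) * Complex.exp ((t : ℂ) * Complex.I))).im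
      - T * (L ((r : ℂ) * Complex.exp ((t : ℂ) * Complex.I))).re + t) (𝓝[<] 1) (𝓝 (β t)))
    (t : ℝ) (n : ℤ) : β (t + n * (2 * Real.pi)) = β t + n * (2 * Real.pi) := by
  have h1 := (hβ t).add_const (n * (2 * Real.pi))
  refine tendsto_nhds_unique (hβ _) (h1.congr fun r => ?_)
  have : Complex.exp (((t + n * (2 * Real.pi) : ℝ) : ℂ) * Complex.I)
      = Complex.exp ((t : ℂ) * Complex.I) := by
    have e : ((t + n * (2 * Real.pi) : ℝ) : ℂ) * Complex.I
      = (t : ℂ) * Complex.I + n * (2 * Real.pi * Complex.I) := by push_cast; ring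
    rw [e, Complex.exp_add, Complex.exp_int_mul_two_pi_mul_I, mul_one]
  rw [this]
  ring

/-- A strip lying in the image forces a jump of at least its width. -/
lemma strip_jump (T : ℝ) (L : ℂ → ℂ) (hL : DifferentiableOn ℂ L (ball (0 : ℂ) 1))
    (hL0 : L 0 = 0)
    (hQ : ∀ z ∈ ball (0 : ℂ) 1, 0 < ((1 - Complex.I * T) * (1 + z * deriv L z)).re)
    (β : ℝ → ℝ) (hmono : Monotone β)
    (hβ : ∀ t : ℝ, Tendsto (fun r : ℝ => (L ((r : ℂ) * Complex.exp ((t : ℂ) * Complex.I))).im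
      - T * (L ((r : ℂ) * Complex.exp ((t : ℂ) * Complex.I))).re + t) (𝓝[<] 1) (𝓝 (β t)))
    {a b : ℝ} (hab : a < b)
    (hstrip : ∀ ψ ∈ Ioo a b, ∀ y : ℝ, ∃ ζ : ℂ, ζ.re < 0 ∧
      logMap T L ζ = (y : ℂ) + (ψ : ℂ) * Complex.I) :
    ∃ τ : ℝ, leftLim β τ ≤ a ∧ b ≤ rightLim β τ := by
  have hbd := logMap_bdry T L β hβ
  have hpi := Real.pi_pos
  have claim : ∀ t1 t2 : ℝ, t1 < t2 → (∀ t ∈ Ioo t1 t2, β t ∈ Ioo a b) → False := by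
    intro t1 t2 h12 hin
    refine no_blowup T L hL hL0 hQ h12 fun t ht => ?_
    have hm := logMap_mono T L hL hQ t
    by_cases hbdd : BddAbove ((fun x : ℝ => (logMap T L (x + t * Complex.I)).re) '' Iio 0)
    · exfalso
      have h1 := hm.tendsto_nhdsLT hbdd
      set y := sSup ((fun x : ℝ => (logMap T L (x + t * Complex.I)).re) '' Iio 0)
      obtain ⟨ζ, hζ, hζe⟩ := hstrip (β t) (hin t ht) y
      refine logMap_not_tendsto T L hL hQ hζ t ?_
      rw [hζe]
      have h2 := (Complex.continuous_ofReal.tendsto _).comp h1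
      have h3 := ((Complex.continuous_ofReal.tendsto _).comp (hbd t)).mul_const Complex.I
      refine (h2.add h3).congr fun x => ?_
      exact Complex.re_add_im _
    · rw [Filter.tendsto_atTop]
      intro C
      rw [not_bddAbove_iff] at hbdd
      obtain ⟨_, ⟨x0, hx0, rfl⟩, hC⟩ := hbdd C
      filter_upwards [Ico_mem_nhdsLT hx0] with x hx
      exact hC.le.trans (hm hx0 hx.2 hx.1)
  set c := (a + b) / 2 with hc
  set S := {t : ℝ | c ≤ β t} with hS
  have hper := beta_periodic T L β hβ
  have hne : S.Nonempty := by
    obtain ⟨n, hn⟩ := exists_int_gt ((c - β 0) / (2 * Real.pi))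
    refine ⟨0 + n * (2 * Real.pi), ?_⟩
    rw [hS, mem_ofPred_eq, hper]
    rw [div_lt_iff₀ (by positivity)] at hn
    linarith
  have hbb : BddBelow S := by
    obtain ⟨n, hn⟩ := exists_int_lt ((c - β 0) / (2 * Real.pi))
    refine ⟨0 + n * (2 * Real.pi), fun t ht => ?_⟩
    by_contra hlt
    have h1 := hmono (not_le.1 hlt).le
    rw [hper] at h1
    rw [lt_div_iff₀ (by positivity)] at hn
    have : c ≤ β t := ht
    linarith
  set τ := sInf S with hτ
  have hlt : ∀ t < τ, β t < c := fun t ht => by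
    by_contra h
    exact absurd (csInf_le hbb (not_lt.1 h : t ∈ S)) (not_le.2 ht)
  have hgt : ∀ t, τ < t → c ≤ β t := fun t ht => by
    obtain ⟨s, hs, hst⟩ := exists_lt_of_csInf_lt hne ht
    exact (show c ≤ β s from hs).trans (hmono hst.le)
  refine ⟨τ, ?_, ?_⟩
  · by_contra h
    have hev := (hmono.tendsto_leftLim τ).eventually (lt_mem_nhds (not_le.1 h))
    obtain ⟨t', ht', hsub⟩ := mem_nhdsLT_iff_exists_Ioo_subset.1 hev
    exact claim t' τ ht' fun t ht => ⟨hsub ht, by linarith [hlt t ht.2]⟩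
  · by_contra h
    have hev := (hmono.tendsto_rightLim τ).eventually (gt_mem_nhds (not_le.1 h))
    obtain ⟨t', ht', hsub⟩ := mem_nhdsGT_iff_exists_Ioo_subset.1 hev
    exact claim τ t' ht' fun t ht => ⟨by linarith [hgt t ht.1], hsub ht⟩

/-- The auxiliary rotated function. -/
lemma rot_setup (T : ℝ) (L : ℂ → ℂ) (hL : DifferentiableOn ℂ L (ball (0 : ℂ) 1))
    (hQ : ∀ z ∈ ball (0 : ℂ) 1, 0 < ((1 - Complex.I * T) * (1 + z * deriv L z)).re)
    (β : ℝ → ℝ) (hmono : Monotone β)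
    (hβ : ∀ t : ℝ, Tendsto (fun r : ℝ => (L ((r : ℂ) * Complex.exp ((t : ℂ) * Complex.I))).im
      - T * (L ((r : ℂ) * Complex.exp ((t : ℂ) * Complex.I))).re + t) (𝓝[<] 1) (𝓝 (β t)))
    (t₀ : ℝ) (M : ℂ → ℂ)
    (hMdef : M = fun z => -Complex.I * ((1 - Complex.I * T) * L (Complex.exp (t₀ * Complex.I) * z))) :
    DifferentiableOn ℂ M (ball (0 : ℂ) 1) ∧
    (∀ r ∈ Ioo (0 : ℝ) 1, Monotone fun t : ℝ => (M (r * Complex.exp (t * Complex.I))).re + t) ∧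
    (∀ t : ℝ, Tendsto (fun r : ℝ => (M (r * Complex.exp (t * Complex.I))).re + t) (𝓝[<] 1)
      (𝓝 (β (t₀ + t) - t₀))) ∧
    Tendsto (fun t => β (t₀ + t) - t₀) (𝓝[<] 0) (𝓝 (leftLim β t₀ - t₀)) ∧
    Tendsto (fun t => β (t₀ + t) - t₀) (𝓝[>] 0) (𝓝 (rightLim β t₀ - t₀)) := by
  have harg : ∀ r t : ℝ, Complex.exp (t₀ * Complex.I) * (r * Complex.exp (t * Complex.I))
      = r * Complex.exp (((t₀ + t : ℝ) : ℂ) * Complex.I) := by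
    intro r t
    have : ((t₀ + t : ℝ) : ℂ) * Complex.I = t₀ * Complex.I + t * Complex.I := by push_cast; ring
    rw [this, Complex.exp_add]; ring
  have hre : ∀ r t : ℝ, (M (r * Complex.exp (t * Complex.I))).re + t
      = (L ((r : ℂ) * Complex.exp (((t₀ + t : ℝ) : ℂ) * Complex.I))).im
      - T * (L ((r : ℂ) * Complex.exp (((t₀ + t : ℝ) : ℂ) * Complex.I))).re + t := by
    intro r t
    simp only [hMdef]
    rw [harg]
    simp
    ring
  refine ⟨?_, ?_, ?_, ?_, ?_⟩
  · rw [hMdef]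
    refine ((hL.comp (differentiableOn_id.const_mul _) ?_).const_mul _).const_mul _
    intro z hz
    simpa [Complex.norm_exp_ofReal_mul_I] using hz
  · intro r hr s t hst
    have hx : Real.log r < 0 := Real.log_neg hr.1 hr.2
    have h1 := (logMap_im_strictMono T L hL hQ hx).monotone (add_le_add_right hst t₀)
    simp only [logMap_im, Real.exp_log hr.1] at h1
    simp only [hre]
    linarith
  · intro t
    have h1 := (hβ (t₀ + t)).sub_const t₀
    refine h1.congr fun r => ?_
    rw [hre]
    ring
  · refine ((hmono.tendsto_leftLim t₀).comp (tendsto_nhdsWithin_iff.2 ⟨?_, ?_⟩)).sub_const t₀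
    · have := ((continuous_const_add t₀).tendsto 0).mono_left (nhdsWithin_le_nhds (s := Iio (0 : ℝ)))
      simpa using this
    · filter_upwards [self_mem_nhdsWithin] with x hx
      simpa using hx
  · refine ((hmono.tendsto_rightLim t₀).comp (tendsto_nhdsWithin_iff.2 ⟨?_, ?_⟩)).sub_const t₀
    · have := ((continuous_const_add t₀).tendsto 0).mono_left (nhdsWithin_le_nhds (s := Ioi (0 : ℝ)))
      simpa using this
    · filter_upwards [self_mem_nhdsWithin] with x hx
      simpa using hx

lemma beta_mid (T : ℝ) (L : ℂ → ℂ) (hL : DifferentiableOn ℂ L (ball (0 : ℂ) 1))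
    (hQ : ∀ z ∈ ball (0 : ℂ) 1, 0 < ((1 - Complex.I * T) * (1 + z * deriv L z)).re)
    (β : ℝ → ℝ) (hmono : Monotone β)
    (hβ : ∀ t : ℝ, Tendsto (fun r : ℝ => (L ((r : ℂ) * Complex.exp ((t : ℂ) * Complex.I))).im
      - T * (L ((r : ℂ) * Complex.exp ((t : ℂ) * Complex.I))).re + t) (𝓝[<] 1) (𝓝 (β t)))
    (t₀ : ℝ) : β t₀ = (leftLim β t₀ + rightLim β t₀) / 2 := by
  obtain ⟨h1, h2, h3, h4, h5⟩ := rot_setup T L hL hQ β hmono hβ t₀ _ rfl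
  have := mid_value _ h1 h2 _ h3 _ _ h4 h5
  simp only [add_zero] at this
  linarith

lemma jump_strip (T : ℝ) (L : ℂ → ℂ) (hL : DifferentiableOn ℂ L (ball (0 : ℂ) 1))
    (hL0 : L 0 = 0)
    (hQ : ∀ z ∈ ball (0 : ℂ) 1, 0 < ((1 - Complex.I * T) * (1 + z * deriv L z)).re)
    (β : ℝ → ℝ) (hmono : Monotone β)
    (hβ : ∀ t : ℝ, Tendsto (fun r : ℝ => (L ((r : ℂ) * Complex.exp ((t : ℂ) * Complex.I))).im
      - T * (L ((r : ℂ) * Complex.exp ((t : ℂ) * Complex.I))).re + t) (𝓝[<] 1) (𝓝 (β t)))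
    (t₀ ψ : ℝ) (hψ : ψ ∈ Ioo (leftLim β t₀) (rightLim β t₀)) (y : ℝ) :
    ∃ ζ : ℂ, ζ.re < 0 ∧ logMap T L ζ = (y : ℂ) + (ψ : ℂ) * Complex.I := by
  have hbd := logMap_bdry T L β hβ
  have hsm : ∀ x : ℝ, x < 0 → StrictMono fun t : ℝ => (logMap T L (x + t * Complex.I)).im :=
    fun x hx => logMap_im_strictMono T L hL hQ hx
  have hcA : ∀ x t : ℝ, x < 0 → ContinuousAt (logMap T L) (x + t * Complex.I) := fun x t hx =>
    logMap_continuousAt T L hL (by simpa using hx)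
  have hct : ∀ x : ℝ, x < 0 → Continuous fun t : ℝ => (logMap T L (x + t * Complex.I)).im := by
    intro x hx
    refine Complex.continuous_re.comp ?_ |>.congr ?_ (f := fun t : ℝ => (-Complex.I * logMap T L (x + t * Complex.I)).re)
    · exact continuous_iff_continuousAt.2 fun t => (ContinuousAt.comp (g := logMap T L)
        (f := fun t : ℝ => (x : ℂ) + t * Complex.I) (hcA x t hx) (by fun_prop)).const_mul _
    · intro t; simp
  have hcx : ∀ x t : ℝ, x < 0 → ContinuousAt (fun x : ℝ => (logMap T L (x + t * Complex.I)).im) x := by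
    intro x t hx
    exact Complex.continuous_im.continuousAt.comp (ContinuousAt.comp (g := logMap T L)
        (f := fun x : ℝ => (x : ℂ) + t * Complex.I) (hcA x t hx) (by fun_prop))
  -- existence of the level curve
  have hex : ∀ x : ℝ, x < 0 → ∃ t : ℝ, (logMap T L (x + t * Complex.I)).im = ψ := by
    intro x hx
    have hper : ∀ (n : ℤ), (logMap T L (x + ((n * (2 * Real.pi) : ℝ) : ℂ) * Complex.I)).im
        = (logMap T L (x + ((0 : ℝ) : ℂ) * Complex.I)).im + n * (2 * Real.pi) := by
      intro n
      have : Complex.exp (((n * (2 * Real.pi) : ℝ) : ℂ) * Complex.I)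
          = Complex.exp (((0 : ℝ) : ℂ) * Complex.I) := by
        have e : ((n * (2 * Real.pi) : ℝ) : ℂ) * Complex.I
          = n * (2 * Real.pi * Complex.I) := by push_cast; ring
        rw [e, Complex.exp_int_mul_two_pi_mul_I]; simp
      rw [logMap_im, logMap_im, this]
      ring
    set q := (logMap T L (x + ((0 : ℝ) : ℂ) * Complex.I)).im with hq
    obtain ⟨n1, hn1⟩ := exists_int_lt ((ψ - q) / (2 * Real.pi))
    obtain ⟨n2, hn2⟩ := exists_int_gt ((ψ - q) / (2 * Real.pi))
    have hpi := Real.pi_pos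
    rw [lt_div_iff₀ (by positivity)] at hn1
    rw [div_lt_iff₀ (by positivity)] at hn2
    have hmem : ψ ∈ range fun t : ℝ => (logMap T L (x + t * Complex.I)).im := by
      refine mem_range_of_exists_le_of_exists_ge (hct x hx) ⟨n1 * (2 * Real.pi), ?_⟩
        ⟨n2 * (2 * Real.pi), ?_⟩
      · rw [hper]; linarith
      · rw [hper]; linarith
    exact hmem
  choose! τ hτ using hex
  have hlt : ∀ x t : ℝ, x < 0 → (logMap T L (x + t * Complex.I)).im < ψ → t < τ x := by
    intro x t hx h
    rw [← hτ x hx] at h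
    exact (hsm x hx).lt_iff_lt.1 h
  have hgt : ∀ x t : ℝ, x < 0 → ψ < (logMap T L (x + t * Complex.I)).im → τ x < t := by
    intro x t hx h
    rw [← hτ x hx] at h
    exact (hsm x hx).lt_iff_lt.1 h
  have hτc : ∀ x : ℝ, x < 0 → ContinuousAt τ x := by
    intro x hx
    have hneg : ∀ᶠ x' : ℝ in 𝓝 x, x' < 0 := gt_mem_nhds hx
    refine tendsto_order.2 ⟨fun t ht => ?_, fun t ht => ?_⟩
    · have h1 : (logMap T L (x + t * Complex.I)).im < ψ := by
        rw [← hτ x hx]; exact hsm x hx ht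
      filter_upwards [(hcx x t hx).eventually (gt_mem_nhds h1), hneg] with x' h2 h3
      exact hlt x' t h3 h2
    · have h1 : ψ < (logMap T L (x + t * Complex.I)).im := by
        rw [← hτ x hx]; exact hsm x hx ht
      filter_upwards [(hcx x t hx).eventually (lt_mem_nhds h1), hneg] with x' h2 h3
      exact hgt x' t h3 h2
  have hτ0 : Tendsto τ (𝓝[<] 0) (𝓝 t₀) := by
    refine tendsto_order.2 ⟨fun t ht => ?_, fun t ht => ?_⟩
    · have h1 : β t < ψ := (hmono.le_leftLim ht).trans_lt hψ.1
      filter_upwards [(hbd t).eventually (gt_mem_nhds h1), self_mem_nhdsWithin] with x' h2 h3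
      exact hlt x' t h3 h2
    · have h1 : ψ < β t := hψ.2.trans_le (hmono.rightLim_le ht)
      filter_upwards [(hbd t).eventually (lt_mem_nhds h1), self_mem_nhdsWithin] with x' h2 h3
      exact hgt x' t h3 h2
  set k : ℝ → ℝ := fun x => (logMap T L (x + τ x * Complex.I)).re with hk
  have hkc : ContinuousOn k (Iio 0) := by
    intro x hx
    refine ContinuousAt.continuousWithinAt ?_
    have hc := hτc x hx
    refine Complex.continuous_re.continuousAt.comp (ContinuousAt.comp (g := logMap T L)
        (f := fun x : ℝ => (x : ℂ) + τ x * Complex.I) (hcA x (τ x) hx) ?_)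
    have : ContinuousAt (fun x : ℝ => ((τ x : ℝ) : ℂ)) x :=
      Complex.continuous_ofReal.continuousAt.comp hc
    exact Complex.continuous_ofReal.continuousAt.add (this.mul_const _)
  -- behaviour at the boundary
  have hktop : Tendsto k (𝓝[<] 0) atTop := by
    obtain ⟨M, hMdef⟩ : ∃ M : ℂ → ℂ, M = fun z => -Complex.I * ((1 - Complex.I * T) *
      L (Complex.exp (t₀ * Complex.I) * z)) := ⟨_, rfl⟩
    obtain ⟨h1, h2, h3, h4, h5⟩ := rot_setup T L hL hQ β hmono hβ t₀ M hMdef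
    set z : ℝ → ℂ := fun x => Complex.exp (x + (τ x - t₀ : ℝ) * Complex.I) with hz
    have harg : ∀ x : ℝ, Complex.exp (t₀ * Complex.I) * z x
        = (Real.exp x : ℝ) * Complex.exp ((τ x : ℂ) * Complex.I) := by
      intro x
      rw [hz, Complex.ofReal_exp, ← Complex.exp_add, ← Complex.exp_add]
      congr 1
      push_cast
      ring
    have hMre : ∀ x : ℝ, x < 0 → (M (z x)).re = ψ - τ x + T * x := by
      intro x hx
      have := hτ x hx
      rw [logMap_im] at this
      simp only [hMdef]
      rw [harg]
      simp only [Complex.mul_re, Complex.mul_im, Complex.neg_re, Complex.neg_im, Complex.I_re,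
        Complex.I_im, Complex.sub_re, Complex.sub_im, Complex.one_re, Complex.one_im,
        Complex.ofReal_re, Complex.ofReal_im]
      linarith
    have hMim : ∀ x : ℝ, k x = -(M (z x)).im + x + T * τ x := by
      intro x
      simp only [hk, logMap_re, hMdef]
      rw [harg]
      simp only [Complex.mul_re, Complex.mul_im, Complex.neg_re, Complex.neg_im, Complex.I_re,
        Complex.I_im, Complex.sub_re, Complex.sub_im, Complex.one_re, Complex.one_im,
        Complex.ofReal_re, Complex.ofReal_im]
      ring
    have hx0 : Tendsto (fun x : ℝ => x) (𝓝[<] 0) (𝓝 0) := nhdsWithin_le_nhds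
    have hzt : Tendsto z (𝓝[<] 0) (𝓝[ball 0 1] 1) := by
      refine tendsto_nhdsWithin_iff.2 ⟨?_, ?_⟩
      · have e1 : Tendsto (fun x : ℝ => (x : ℂ) + (τ x - t₀ : ℝ) * Complex.I) (𝓝[<] 0)
            (𝓝 (((0 : ℝ) : ℂ) + (t₀ - t₀ : ℝ) * Complex.I)) :=
          ((Complex.continuous_ofReal.tendsto _).comp hx0).add
            (((Complex.continuous_ofReal.tendsto _).comp (hτ0.sub_const t₀)).mul_const _)
        have e2 := (Complex.continuous_exp.tendsto _).comp e1
        have e3 : Complex.exp (((0 : ℝ) : ℂ) + (t₀ - t₀ : ℝ) * Complex.I) = 1 := by simp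
        rw [e3] at e2
        exact e2
      · filter_upwards [self_mem_nhdsWithin] with x hx
        exact exp_mem (by simpa using hx)
    have hMt : Tendsto (fun x => (M (z x)).re) (𝓝[<] 0) (𝓝 (ψ - t₀)) := by
      have e1 : Tendsto (fun x => ψ - τ x + T * x) (𝓝[<] 0) (𝓝 (ψ - t₀ + T * 0)) :=
        (hτ0.const_sub ψ).add (hx0.const_mul T)
      rw [mul_zero, add_zero] at e1
      refine e1.congr' ?_
      filter_upwards [self_mem_nhdsWithin] with x hx
      exact (hMre x hx).symm
    have him := im_tendsto M h1 h2 _ h3 _ _ h4 h5 _ z hzt (ψ - t₀)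
      ⟨by linarith [hψ.1], by linarith [hψ.2]⟩ hMt
    have e2 : Tendsto (fun x => x + T * τ x) (𝓝[<] 0) (𝓝 (0 + T * t₀)) :=
      hx0.add (hτ0.const_mul T)
    have e3 := (tendsto_neg_atBot_atTop.comp him).atTop_add e2
    refine e3.congr fun x => ?_
    rw [hMim]
    simp only [Function.comp_apply]
    ring
  have hkbot : Tendsto k atBot atBot := by
    set W : ℝ → ℂ := fun x => (1 - Complex.I * T) *
      L ((Real.exp x : ℝ) * Complex.exp ((τ x : ℂ) * Complex.I)) with hW
    have hWt : Tendsto W atBot (𝓝 0) := by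
      have e1 : Tendsto (fun x : ℝ => (Real.exp x : ℝ) * Complex.exp ((τ x : ℂ) * Complex.I)) atBot
          (𝓝 0) := by
        rw [tendsto_zero_iff_norm_tendsto_zero]
        refine Real.tendsto_exp_atBot.congr fun x => ?_
        rw [norm_mul, Complex.norm_exp_ofReal_mul_I, mul_one, Complex.norm_real, Real.norm_eq_abs,
          abs_of_pos (Real.exp_pos _)]
      have hc : ContinuousAt L 0 :=
        (hL.differentiableAt (isOpen_ball.mem_nhds (by simp))).continuousAt
      have e2 := (hc.tendsto.comp e1).const_mul (1 - Complex.I * T)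
      rw [hL0, mul_zero] at e2
      exact e2
    have hre := (Complex.continuous_re.tendsto _).comp hWt
    have him := (Complex.continuous_im.tendsto _).comp hWt
    have hkx : ∀ x : ℝ, x < 0 → k x = (1 + T ^ 2) * x + ((W x).re + T * (ψ - (W x).im)) := by
      intro x hx
      have h1 := hτ x hx
      have h2 : τ x = ψ - (W x).im + T * x := by
        rw [logMap_im] at h1
        simp only [hW, Complex.mul_re, Complex.mul_im, Complex.I_re,
          Complex.I_im, Complex.sub_re, Complex.sub_im, Complex.one_re, Complex.one_im,
          Complex.ofReal_re, Complex.ofReal_im]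
        linarith
      have h3 : k x = (W x).re + x + T * τ x := by simp only [hk, hW, logMap_re]
      rw [h3, h2]
      ring
    have e1 : Tendsto (fun x : ℝ => (1 + T ^ 2) * x) atBot atBot :=
      tendsto_id.const_mul_atBot (by positivity)
    have e2 := e1.atBot_add (hre.add ((him.const_sub ψ).const_mul T))
    refine e2.congr' ?_
    filter_upwards [Iio_mem_atBot (0 : ℝ)] with x hx
    rw [hkx x hx]
    rfl
  -- intermediate value
  obtain ⟨x1, hx1, hx1'⟩ := ((hkbot.eventually (eventually_le_atBot y)).and
    (Iio_mem_atBot (0 : ℝ))).exists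
  have hself : ∀ᶠ x : ℝ in 𝓝[<] (0 : ℝ), x < 0 := self_mem_nhdsWithin
  obtain ⟨x2, hx2, hx2'⟩ := ((hktop.eventually (eventually_ge_atTop y)).and hself).exists
  obtain ⟨x, hx, hxy⟩ := isPreconnected_Iio.intermediate_value (a := x1) (b := x2) hx1' hx2' hkc
    (show y ∈ Icc (k x1) (k x2) from ⟨hx1, hx2⟩)
  refine ⟨x + τ x * Complex.I, by simpa using hx, ?_⟩
  apply Complex.ext
  · simpa using hxy
  · simpa using hτ x hx

/-- for `f ∈ F_λ` with boundary angle function `β`, the jump of `β` at `t₀`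
equals `θ ∈ (0, 2π]` if and only if `f(𝔻)` contains the maximal `λ`-spiral sector
`S_λ(β(t₀), θ)`. -/
theorem jump_iff_maximal_spiral_sector (lam : ℝ)
    (hlam : lam ∈ Set.Ioo (-(Real.pi / 2)) (Real.pi / 2))
    (f : ℂ → ℂ) (hf : f ∈ SpiralClass lam) (L : ℂ → ℂ) (hL : IsLogBranch f L)
    (β : ℝ → ℝ) (hmono : Monotone β)
    (hβ : ∀ t : ℝ, Tendsto
        (fun r : ℝ => lambdaArgBranch lam L ((r : ℂ) * Complex.exp ((t : ℂ) * Complex.I)) + t)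
        (𝓝[<] 1) (𝓝 (β t)))
    (t₀ : ℝ) (θ : ℝ) (hθ : θ ∈ Set.Ioc 0 (2 * Real.pi)) :
    Function.rightLim β t₀ - Function.leftLim β t₀ = θ ↔
      IsMaximalSpiralSector lam (β t₀) θ (f '' ball (0 : ℂ) 1) := by
  obtain ⟨hfd, hf0, -, hfne, hfp⟩ := hf
  obtain ⟨hLd, hL0, hLe⟩ := hL
  have hQ := spiral_hQ lam hlam f L hf0 hfp hLd hLe
  have hcos : 0 < Real.cos lam := Real.cos_pos_of_mem_Ioo hlam
  have hiff := sector_mem_iff lam hlam f L hf0 hLe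
  have hmid := beta_mid (Real.tan lam) L hLd hQ β hmono hβ t₀
  set bm := leftLim β t₀ with hbm
  set bp := rightLim β t₀ with hbp
  -- part A
  have hA : ∀ c a : ℝ, bm ≤ c - a / 2 → c + a / 2 ≤ bp →
      spiralSector lam c a ⊆ f '' ball (0 : ℂ) 1 := by
    rintro c a h1 h2 w ⟨s, ψ, hψ, rfl⟩
    rw [abs_lt] at hψ
    rw [hiff]
    exact jump_strip (Real.tan lam) L hLd hL0 hQ β hmono hβ t₀ ψ
      ⟨by linarith, by linarith⟩ _
  -- part B
  have hB : ∀ c a : ℝ, |β t₀ - c| < a / 2 →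
      spiralSector lam c a ⊆ f '' ball (0 : ℂ) 1 → bm ≤ c - a / 2 ∧ c + a / 2 ≤ bp := by
    intro c a hc hsub
    rw [abs_lt] at hc
    obtain ⟨τ, h1, h2⟩ := strip_jump (Real.tan lam) L hLd hL0 hQ β hmono hβ
      (a := c - a / 2) (b := c + a / 2) (by linarith) (by
        intro ψ hψ y
        have hm := hsub ⟨(y - Real.tan lam * ψ) * Real.cos lam, ψ,
          abs_lt.2 ⟨by linarith [hψ.1], by linarith [hψ.2]⟩, rfl⟩
        rw [hiff] at hm
        have e : Real.tan lam * ψ + (y - Real.tan lam * ψ) * Real.cos lam / Real.cos lam = y := by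
          field_simp
          ring
        rwa [e] at hm)
    have hτ : τ = t₀ := by
      rcases lt_trichotomy τ t₀ with h | h | h
      · have := hmono.rightLim_le h
        linarith
      · exact h
      · have := hmono.le_leftLim h
        linarith
    subst hτ
    exact ⟨h1, h2⟩
  -- shifting a sector by a full turn
  have hshift : ∀ (c a : ℝ) (k : ℤ),
      spiralSector lam (c + k * (2 * Real.pi)) a ⊆ spiralSector lam c a := by
    rintro c a k w ⟨s, ψ, hψ, rfl⟩
    refine ⟨s, ψ - k * (2 * Real.pi), ?_, ?_⟩
    · convert hψ using 2
      ring
    · rw [Complex.exp_eq_exp_iff_exists_int]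
      exact ⟨k, by push_cast; ring⟩
  constructor
  · intro hj
    refine ⟨hA _ _ (by linarith) (by linarith), ?_⟩
    rintro ⟨a', c', ha', hs1, hs2⟩
    have hmem : Complex.exp ((β t₀ : ℂ) * Complex.I + ((0 : ℝ) : ℂ) *
        Complex.exp ((lam : ℂ) * Complex.I)) ∈ spiralSector lam c' a' :=
      hs1 ⟨0, β t₀, by simpa using hθ.1, rfl⟩
    obtain ⟨s, ψ, hψ, he⟩ := hmem
    obtain ⟨k, hk⟩ := Complex.exp_eq_exp_iff_exists_int.1 he
    have hre := congrArg Complex.re hk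
    have him := congrArg Complex.im hk
    rw [Complex.exp_mul_I, ← Complex.ofReal_cos, ← Complex.ofReal_sin] at hre him
    simp at hre him
    have hs0 : s = 0 := hre.resolve_right hcos.ne'
    rw [hs0] at him
    have h3 := hB (c' + k * (2 * Real.pi)) a' (by
      convert hψ using 2
      rw [him]
      ring) ((hshift c' a' k).trans hs2)
    linarith [h3.1, h3.2]
  · rintro ⟨hsub, hmax⟩
    obtain ⟨h1, h2⟩ := hB (β t₀) θ (by simpa using hθ.1) hsub
    by_contra hne
    have hgt : θ < bp - bm := lt_of_le_of_ne (by linarith) (Ne.symm hne)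
    refine hmax ⟨bp - bm, β t₀, hgt, ?_, hA _ _ (by linarith) (by linarith)⟩
    rintro w ⟨s, ψ, hψ, rfl⟩
    exact ⟨s, ψ, by linarith, rfl⟩
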